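/- The logic WK has the uniform interpolation property: for every formula φ and every propositional variable p there exist formulas ∃pφ and ∀pφ such that (1) vars(∃pφ) ⊆ vars(φ)\{p} and vars(∀pφ) ⊆ vars(φ)\{p}; (2) ⊢_WK φ → ∃pφ and ⊢_WK ∀pφ → φ; and (3) for every formula ψ with p ∉ vars(ψ): if ⊢_WK φ → ψ then ⊢_WK ∃pφ → ψ, and if ⊢_WK ψ → φ then ⊢_WK ψ → ∀pφ. -/

import Mathlib

/-- Formulas of the modal language: φ ::= p | ⊥ | φ∧φ | φ∨φ | φ→φ | □φ | ◇φ. -/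
inductive Form : Type
  | var : ℕ → Form
  | bot : Form
  | and : Form → Form → Form
  | or  : Form → Form → Form
  | imp : Form → Form → Form
  | box : Form → Form
  | dia : Form → Form
  deriving DecidableEq

/-- Helper for □⁻¹: remove an outer box. -/
def unboxF : Form → Option Form
  | Form.box φ => some φ
  | _ => none

/-- □⁻¹Γ := {φ | □φ ∈ Γ}, as a multiset operation. -/
def boxInv (Γ : Multiset Form) : Multiset Form := Γ.filterMap unboxF

/-- ◇⁻¹Δ for a succedent Δ with at most one formula (modelled by `Option`). -/
def diaInv : Option Form → Option Form
  | some (Form.dia φ) => some φ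
  | _ => none

/-- Provability in the sequent calculus G4CK: sequents Γ ⇒ δ with a
multiset antecedent and a single-formula succedent. -/
inductive G4CK : Multiset Form → Form → Prop
  | botL (Γ δ) : G4CK (Form.bot ::ₘ Γ) δ
  | idP (Γ n) : G4CK (Form.var n ::ₘ Γ) (Form.var n)
  | andL (Γ φ ψ δ) : G4CK (φ ::ₘ ψ ::ₘ Γ) δ → G4CK (Form.and φ ψ ::ₘ Γ) δ
  | andR (Γ φ ψ) : G4CK Γ φ → G4CK Γ ψ → G4CK Γ (Form.and φ ψ)
  | orL (Γ φ ψ δ) : G4CK (φ ::ₘ Γ) δ → G4CK (ψ ::ₘ Γ) δ → G4CK (Form.or φ ψ ::ₘ Γ) δ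
  | orR1 (Γ φ ψ) : G4CK Γ φ → G4CK Γ (Form.or φ ψ)
  | orR2 (Γ φ ψ) : G4CK Γ ψ → G4CK Γ (Form.or φ ψ)
  | impR (Γ φ ψ) : G4CK (φ ::ₘ Γ) ψ → G4CK Γ (Form.imp φ ψ)
  | andImpL (Γ φ ψ χ δ) :
      G4CK (Form.imp φ (Form.imp ψ χ) ::ₘ Γ) δ →
      G4CK (Form.imp (Form.and φ ψ) χ ::ₘ Γ) δ
  | orImpL (Γ φ ψ χ δ) :
      G4CK (Form.imp φ χ ::ₘ Form.imp ψ χ ::ₘ Γ) δ →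
      G4CK (Form.imp (Form.or φ ψ) χ ::ₘ Γ) δ
  | pImpL (Γ n φ δ) :
      G4CK (Form.var n ::ₘ φ ::ₘ Γ) δ →
      G4CK (Form.var n ::ₘ Form.imp (Form.var n) φ ::ₘ Γ) δ
  | impImpL (Γ φ ψ χ δ) :
      G4CK (Form.imp ψ χ ::ₘ Γ) (Form.imp φ ψ) → G4CK (χ ::ₘ Γ) δ →
      G4CK (Form.imp (Form.imp φ ψ) χ ::ₘ Γ) δ
  | boxR (Γ φ) : G4CK (boxInv Γ) φ → G4CK Γ (Form.box φ)
  | boxImpL (Γ φ ψ δ) :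
      G4CK (boxInv Γ) φ → G4CK (ψ ::ₘ Γ) δ →
      G4CK (Form.imp (Form.box φ) ψ ::ₘ Γ) δ
  | diaImpL (Γ γ φ ψ δ) :
      G4CK (γ ::ₘ boxInv Γ) φ → G4CK (ψ ::ₘ Form.dia γ ::ₘ Γ) δ →
      G4CK (Form.imp (Form.dia φ) ψ ::ₘ Form.dia γ ::ₘ Γ) δ
  | diaL (Γ φ ψ) : G4CK (φ ::ₘ boxInv Γ) ψ → G4CK (Form.dia φ ::ₘ Γ) (Form.dia ψ)

/-- Provability in the sequent calculus G4WK: sequents Γ ⇒ Δ with a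
multiset antecedent and a succedent with at most one formula (`Option Form`). -/
inductive G4WK : Multiset Form → Option Form → Prop
  | botL (Γ Δ) : G4WK (Form.bot ::ₘ Γ) Δ
  | idP (Γ n) : G4WK (Form.var n ::ₘ Γ) (some (Form.var n))
  | andL (Γ φ ψ Δ) : G4WK (φ ::ₘ ψ ::ₘ Γ) Δ → G4WK (Form.and φ ψ ::ₘ Γ) Δ
  | andR (Γ φ ψ) : G4WK Γ (some φ) → G4WK Γ (some ψ) → G4WK Γ (some (Form.and φ ψ))
  | orL (Γ φ ψ Δ) : G4WK (φ ::ₘ Γ) Δ → G4WK (ψ ::ₘ Γ) Δ → G4WK (Form.or φ ψ ::ₘ Γ) Δ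
  | orR1 (Γ φ ψ) : G4WK Γ (some φ) → G4WK Γ (some (Form.or φ ψ))
  | orR2 (Γ φ ψ) : G4WK Γ (some ψ) → G4WK Γ (some (Form.or φ ψ))
  | impR (Γ φ ψ) : G4WK (φ ::ₘ Γ) (some ψ) → G4WK Γ (some (Form.imp φ ψ))
  | andImpL (Γ φ ψ χ Δ) :
      G4WK (Form.imp φ (Form.imp ψ χ) ::ₘ Γ) Δ →
      G4WK (Form.imp (Form.and φ ψ) χ ::ₘ Γ) Δ
  | orImpL (Γ φ ψ χ Δ) :
      G4WK (Form.imp φ χ ::ₘ Form.imp ψ χ ::ₘ Γ) Δ →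
      G4WK (Form.imp (Form.or φ ψ) χ ::ₘ Γ) Δ
  | pImpL (Γ n φ Δ) :
      G4WK (Form.var n ::ₘ φ ::ₘ Γ) Δ →
      G4WK (Form.var n ::ₘ Form.imp (Form.var n) φ ::ₘ Γ) Δ
  | impImpL (Γ φ ψ χ Δ) :
      G4WK (Form.imp ψ χ ::ₘ Γ) (some (Form.imp φ ψ)) → G4WK (χ ::ₘ Γ) Δ →
      G4WK (Form.imp (Form.imp φ ψ) χ ::ₘ Γ) Δ
  | boxR (Γ φ) : G4WK (boxInv Γ) (some φ) → G4WK Γ (some (Form.box φ))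
  | boxImpL (Γ φ ψ Δ) :
      G4WK (boxInv Γ) (some φ) → G4WK (ψ ::ₘ Γ) Δ →
      G4WK (Form.imp (Form.box φ) ψ ::ₘ Γ) Δ
  | diaImpL (Γ γ φ ψ Δ) :
      G4WK (γ ::ₘ boxInv Γ) (some φ) → G4WK (ψ ::ₘ Form.dia γ ::ₘ Γ) Δ →
      G4WK (Form.imp (Form.dia φ) ψ ::ₘ Form.dia γ ::ₘ Γ) Δ
  | diaL' (Γ φ Δ) : G4WK (φ ::ₘ boxInv Γ) (diaInv Δ) → G4WK (Form.dia φ ::ₘ Γ) Δ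

/-- Axiom schemes of the generalised Hilbert calculus CKH:
intuitionistic axioms A1–A9 together with K_□ and K_◇. -/
inductive CKAx : Form → Prop
  | a1 (φ ψ : Form) : CKAx (φ.imp (ψ.imp φ))
  | a2 (φ ψ χ : Form) : CKAx ((φ.imp (ψ.imp χ)).imp ((φ.imp ψ).imp (φ.imp χ)))
  | a3 (φ ψ : Form) : CKAx (φ.imp (φ.or ψ))
  | a4 (φ ψ : Form) : CKAx (ψ.imp (φ.or ψ))
  | a5 (φ ψ χ : Form) : CKAx ((φ.imp χ).imp ((ψ.imp χ).imp ((φ.or ψ).imp χ)))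
  | a6 (φ ψ : Form) : CKAx ((φ.and ψ).imp φ)
  | a7 (φ ψ : Form) : CKAx ((φ.and ψ).imp ψ)
  | a8 (φ ψ χ : Form) : CKAx ((φ.imp ψ).imp ((φ.imp χ).imp (φ.imp (ψ.and χ))))
  | a9 (φ : Form) : CKAx (Form.bot.imp φ)
  | kbox (φ ψ : Form) : CKAx ((φ.imp ψ).box.imp (φ.box.imp ψ.box))
  | kdia (φ ψ : Form) : CKAx ((φ.imp ψ).box.imp (φ.dia.imp ψ.dia))

/-- Axiom schemes of WKH: those of CKH together with N : ¬◇⊥. -/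
inductive WKAx : Form → Prop
  | ck {φ : Form} : CKAx φ → WKAx φ
  | n : WKAx (Form.bot.dia.imp Form.bot)

/-- Derivability Γ ⊢ φ in the generalised Hilbert calculus CKH. -/
inductive CKH : Set Form → Form → Prop
  | ax {Γ : Set Form} {φ : Form} : CKAx φ → CKH Γ φ
  | el {Γ : Set Form} {φ : Form} : φ ∈ Γ → CKH Γ φ
  | mp {Γ : Set Form} {φ ψ : Form} : CKH Γ φ → CKH Γ (φ.imp ψ) → CKH Γ ψ
  | nec {Γ : Set Form} {φ : Form} : CKH ∅ φ → CKH Γ φ.box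

/-- Derivability Γ ⊢ φ in the generalised Hilbert calculus WKH. -/
inductive WKH : Set Form → Form → Prop
  | ax {Γ : Set Form} {φ : Form} : WKAx φ → WKH Γ φ
  | el {Γ : Set Form} {φ : Form} : φ ∈ Γ → WKH Γ φ
  | mp {Γ : Set Form} {φ ψ : Form} : WKH Γ φ → WKH Γ (φ.imp ψ) → WKH Γ ψ
  | nec {Γ : Set Form} {φ : Form} : WKH ∅ φ → WKH Γ φ.box

/-- The set of propositional variables occurring in a formula. -/
def vars : Form → Set ℕ
  | .var n => {n}
  | .bot => ∅
  | .and φ ψ => vars φ ∪ vars ψ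
  | .or φ ψ => vars φ ∪ vars ψ
  | .imp φ ψ => vars φ ∪ vars ψ
  | .box φ => vars φ
  | .dia φ => vars φ

/-- Variables occurring in a multiset of formulas. -/
def varsM (Γ : Multiset Form) : Set ℕ := {n | ∃ φ ∈ Γ, n ∈ vars φ}

/-- Variables occurring in a succedent with at most one formula. -/
def varsO : Option Form → Set ℕ
  | none => ∅
  | some φ => vars φ

open Set

universe u

/-- Models of WK: a preorder together with, at every world, a nonempty family of
neighbourhoods, interpreting `□` universally and `◇` by a `∀∃` pattern. -/
structure WKModel (W : Type u) where
  le : W → W → Prop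
  refl : ∀ w, le w w
  trans : ∀ {w v x}, le w v → le v x → le w x
  nb : W → Set W → Prop
  nb_exists : ∀ w, ∃ S, nb w S
  val : W → ℕ → Prop

namespace WKModel

variable {W : Type u} (M : WKModel W)

def force : Form → W → Prop
  | .var q, w => ∀ v, M.le w v → M.val v q
  | .bot, _ => False
  | .and φ ψ, w => force φ w ∧ force ψ w
  | .or φ ψ, w => force φ w ∨ force ψ w
  | .imp φ ψ, w => ∀ v, M.le w v → force φ v → force ψ v
  | .box φ, w => ∀ v, M.le w v → ∀ S, M.nb v S → ∀ z ∈ S, force φ z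
  | .dia φ, w => ∀ v, M.le w v → ∀ S, M.nb v S → ∃ z ∈ S, force φ z

theorem force_mono {φ : Form} {w v : W} (h : M.le w v) (hw : M.force φ w) : M.force φ v := by
  induction φ with
  | var q => exact fun x hx => hw x (M.trans h hx)
  | bot => exact hw
  | and φ ψ ih₁ ih₂ => exact ⟨ih₁ hw.1, ih₂ hw.2⟩
  | or φ ψ ih₁ ih₂ => exact hw.imp ih₁ ih₂
  | imp φ ψ => exact fun x hx => hw x (M.trans h hx)
  | box φ => exact fun x hx => hw x (M.trans h hx)
  | dia φ => exact fun x hx => hw x (M.trans h hx)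

theorem force_mp {φ ψ : Form} {w : W} (h : M.force (φ.imp ψ) w) (hφ : M.force φ w) :
    M.force ψ w :=
  h w (M.refl w) hφ

theorem force_of_wkAx {φ : Form} (h : WKAx φ) (w : W) : M.force φ w := by
  rcases h with h | _
  · cases h with
    | a1 φ ψ => exact fun v _ hφ x hx _ => M.force_mono hx hφ
    | a2 φ ψ χ =>
      exact fun v _ h₁ x hx h₂ y hy h₃ =>
        M.force_mp (h₁ y (M.trans hx hy) h₃) (h₂ y hy h₃)
    | a3 φ ψ => exact fun v _ h => Or.inl h
    | a4 φ ψ => exact fun v _ h => Or.inr h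
    | a5 φ ψ χ =>
      exact fun v _ h₁ x hx h₂ y hy h₃ => h₃.elim (h₁ y (M.trans hx hy)) (h₂ y hy)
    | a6 φ ψ => exact fun v _ h => h.1
    | a7 φ ψ => exact fun v _ h => h.2
    | a8 φ ψ χ =>
      exact fun v _ h₁ x hx h₂ y hy h₃ => ⟨h₁ y (M.trans hx hy) h₃, h₂ y hy h₃⟩
    | a9 φ => exact fun v _ h => h.elim
    | kbox φ ψ =>
      exact fun v _ h₁ x hx h₂ y hy S hS z hz =>
        M.force_mp (h₁ y (M.trans hx hy) S hS z hz) (h₂ y hy S hS z hz)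
    | kdia φ ψ =>
      intro v _ h₁ x hx h₂ y hy S hS
      obtain ⟨z, hz, hφ⟩ := h₂ y hy S hS
      exact ⟨z, hz, M.force_mp (h₁ y (M.trans hx hy) S hS z hz) hφ⟩
  · intro v _ h
    obtain ⟨S, hS⟩ := M.nb_exists v
    obtain ⟨z, _, hz⟩ := h v (M.refl v) S hS
    exact hz

theorem sound {Γ : Set Form} {φ : Form} (h : WKH Γ φ) :
    ∀ w, (∀ χ ∈ Γ, M.force χ w) → M.force φ w := by
  induction h with
  | ax h => exact fun w _ => M.force_of_wkAx h w
  | el h => exact fun w hw => hw _ h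
  | mp _ _ ih₁ ih₂ => exact fun w hw => M.force_mp (ih₂ w hw) (ih₁ w hw)
  | nec _ ih => exact fun w _ v _ S _ z _ => ih z (by simp)

/-- The worlds all of whose formulas are constrained by the boxed formulas of `w`. -/
def Reach (w z : W) : Prop := ∃ v, M.le w v ∧ ∃ S, M.nb v S ∧ ∃ y ∈ S, M.le y z

theorem force_of_reach {φ : Form} {w z : W} (h : M.Reach w z) (hw : M.force φ.box w) :
    M.force φ z := by
  obtain ⟨v, hv, S, hS, y, hy, hz⟩ := h
  exact M.force_mono hz (hw v hv S hS y hy)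

end WKModel

/-- Well-founded trees of worlds; each node carries a family `suc` of neighbourhoods. -/
inductive WTree : Type (u + 1)
  | node (val : ℕ → Prop) (I : Type u) (up : I → WTree) (K : Type u) (k₀ : K)
      (J : K → Type u) (suc : (k : K) → J k → WTree) : WTree

namespace WTree

def Child : WTree.{u} → WTree.{u} → Prop
  | node _ I up _ _ _ _, t => ∃ i : I, up i = t

def val : WTree.{u} → ℕ → Prop
  | node v _ _ _ _ _ _ => v

def nb : WTree.{u} → Set WTree.{u} → Prop
  | node _ _ _ K _ _ suc, S => ∃ k : K, Set.range (suc k) = S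

/-- The class of all trees, seen as one model. -/
def model : WKModel WTree.{u} where
  le := Relation.ReflTransGen Child
  refl _ := Relation.ReflTransGen.refl
  trans := Relation.ReflTransGen.trans
  nb := nb
  nb_exists := by rintro ⟨v, I, up, K, k₀, J, suc⟩; exact ⟨_, k₀, rfl⟩
  val := val

abbrev force (φ : Form) (t : WTree.{u}) : Prop := model.force φ t

theorem le_node {v : ℕ → Prop} {I : Type u} {up : I → WTree.{u}} {K : Type u} {k₀ : K}
    {J : K → Type u} {suc : (k : K) → J k → WTree.{u}} {t : WTree.{u}} :
    model.le (node v I up K k₀ J suc) t ↔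
      t = node v I up K k₀ J suc ∨ ∃ i, model.le (up i) t := by
  constructor
  · intro h
    rcases Relation.ReflTransGen.cases_head h with h | ⟨_, ⟨i, rfl⟩, h⟩
    · exact .inl h.symm
    · exact .inr ⟨i, h⟩
  · rintro (rfl | ⟨i, h⟩)
    · exact model.refl _
    · exact Relation.ReflTransGen.head ⟨i, rfl⟩ h

end WTree

/-- A formula that is always true. -/
def Form.top : Form := Form.bot.imp Form.bot

theorem WKModel.force_top {W : Type u} (M : WKModel W) (w : W) : M.force Form.top w :=
  fun _ _ h => h

section Realisation

variable {W : Type u} (M : WKModel W) (b : Prop) (p : ℕ)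

/-- Some tree satisfies `Γ` and refutes `δ`; if `b` holds, it moreover agrees with `w` on all
formulas without the variable `p`. -/
def Sat (w : W) (Γ : Set Form) (δ : Form) : Prop :=
  ∃ t : WTree.{u}, (b → ∀ χ, p ∉ vars χ → (t.force χ ↔ M.force χ w)) ∧
    (∀ χ ∈ Γ, t.force χ) ∧ ¬ t.force δ

def unboxed (Γ : Set Form) : Set Form := {φ | φ.box ∈ Γ}

def RefutesBox (w : W) (Γ : Set Form) (φ : Form) : Prop :=
  ∃ z, M.Reach w z ∧ Sat M b p z (unboxed Γ) φ

def RefutesDia (w : W) (Γ : Set Form) (φ : Form) : Prop :=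
  (b → ∃ v, M.le w v ∧ ∃ S, M.nb v S ∧ ∀ z ∈ S, ∃ y, M.le z y ∧ Sat M b p y (unboxed Γ) φ) ∧
  ∀ γ : Form, γ.dia ∈ Γ → ∃ z, M.Reach w z ∧ Sat M b p z (insert γ (unboxed Γ)) φ

/-- The atoms forced at the root of a tree realising `Γ` over `w`. -/
def RootAtom (w : W) (Γ : Set Form) (q : ℕ) : Prop :=
  Form.var q ∈ Γ ∨ (b ∧ q ≠ p ∧ M.force (.var q) w)

/-- The condition under which an antecedent formula needs no further decomposition. -/
def Settled (w : W) (Γ : Set Form) : Form → Prop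
  | .var q => b → q ≠ p → M.force (.var q) w
  | .box _ => True
  | .dia _ => True
  | .imp (.var q) _ => ¬ RootAtom M b p w Γ q
  | .imp (.imp φ ψ) _ => ∃ v, M.le w v ∧ Sat M b p v (insert φ Γ) ψ
  | .imp (.box φ) _ => RefutesBox M b p w Γ φ
  | .imp (.dia φ) _ => RefutesDia M b p w Γ φ
  | _ => False

/-- The condition under which a succedent is refuted at the root. -/
def Refuted (w : W) (Γ : Set Form) : Form → Prop
  | .var q => ¬ RootAtom M b p w Γ q
  | .bot => True
  | .and φ ψ => ∃ v, M.le w v ∧ (Sat M b p v Γ φ ∨ Sat M b p v Γ ψ)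
  | .or φ ψ => (∃ v, M.le w v ∧ Sat M b p v Γ φ) ∧ ∃ v, M.le w v ∧ Sat M b p v Γ ψ
  | .imp φ ψ => ∃ v, M.le w v ∧ Sat M b p v (insert φ Γ) ψ
  | .box φ => RefutesBox M b p w Γ φ
  | .dia φ => RefutesDia M b p w Γ φ

variable {M b p}

theorem Sat.mono {w : W} {Γ Γ' : Set Form} {δ : Form} (h : Sat M b p w Γ δ)
    (hΓ : ∀ t : WTree.{u}, (∀ χ ∈ Γ, t.force χ) → ∀ χ ∈ Γ', t.force χ) : Sat M b p w Γ' δ := by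
  obtain ⟨t, h₁, h₂, h₃⟩ := h
  exact ⟨t, h₁, hΓ t h₂, h₃⟩

theorem Sat.insert_top {w : W} {Γ : Set Form} {δ : Form} (h : Sat M b p w Γ δ) :
    Sat M b p w (insert Form.top Γ) δ :=
  h.mono fun t ht χ hχ => by
    rcases hχ with rfl | hχ
    · exact WTree.model.force_top t
    · exact ht χ hχ

/-- Realising settled sequents: witnesses for all decompositions are collected above one
new root. -/
theorem sat_of_settled {w : W} {Γ : Set Form} {δ : Form}
    (hup : b → ∀ v, M.le w v → v ≠ w → ∃ x, M.le w x ∧ M.le x v ∧ Sat M b p x Γ .bot)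
    (hnb : ∀ S, M.nb w S → (b → ∀ z ∈ S, Sat M b p z (unboxed Γ) .bot) ∧
      ∀ γ : Form, γ.dia ∈ Γ → ∃ z ∈ S, Sat M b p z (insert γ (unboxed Γ)) .bot)
    (hΓ : ∀ χ ∈ Γ, Settled M b p w Γ χ) (hδ : Refuted M b p w Γ δ) :
    Sat M b p w Γ δ := by
  classical
  let I : Type u := {x : W × Form × Form // M.le w x.1 ∧ Sat M b p x.1 (insert x.2.1 Γ) x.2.2}
  let P : Type u := {x : W × Form × Form //
    M.Reach w x.1 ∧ Sat M b p x.1 (insert x.2.1 (unboxed Γ)) x.2.2}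
  choose up hup₁ hup₂ hup₃ using fun x : I => x.2.2
  choose pool hpool₁ hpool₂ hpool₃ using fun x : P => x.2.2
  let Good : Set P → Prop := fun X =>
    (∀ γ : Form, γ.dia ∈ Γ → ∃ a ∈ X, (pool a).force γ) ∧
    (b → ∃ v, M.le w v ∧ ∃ S, M.nb v S ∧ ∀ z ∈ S, ∃ a ∈ X, M.le z a.1.1)
  have mkP : ∀ {z γ φ}, M.Reach w z → Sat M b p z (insert γ (unboxed Γ)) φ →
      ∃ a : P, a.1.1 = z ∧ a.1.2.2 = φ ∧ (pool a).force γ ∧ ¬ (pool a).force φ := by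
    intro z γ φ h₁ h₂
    exact ⟨⟨(z, γ, φ), h₁, h₂⟩, rfl, rfl, hpool₂ _ _ (by simp), hpool₃ ⟨(z, γ, φ), h₁, h₂⟩⟩
  have mkI : ∀ {v φ ψ}, M.le w v → Sat M b p v (insert φ Γ) ψ →
      ∃ i : I, i.1.1 = v ∧ (up i).force φ ∧ ¬ (up i).force ψ := by
    intro z γ φ h₁ h₂
    exact ⟨⟨(z, γ, φ), h₁, h₂⟩, rfl, hup₂ _ _ (by simp), hup₃ ⟨(z, γ, φ), h₁, h₂⟩⟩
  have reach_nb : ∀ {S z y}, M.nb w S → z ∈ S → M.le z y → M.Reach w y :=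
    fun hS hz hy => ⟨w, M.refl w, _, hS, _, hz, hy⟩
  have good_base : ∀ S, M.nb w S → Good {a | a.1.1 ∈ S} := by
    intro S hS
    refine ⟨fun γ hγ => ?_, fun hb => ⟨w, M.refl w, S, hS, fun z hz => ?_⟩⟩
    · obtain ⟨z, hz, h⟩ := (hnb S hS).2 γ hγ
      obtain ⟨a, ha, -, h', -⟩ := mkP (reach_nb hS hz (M.refl z)) h
      exact ⟨a, by simpa [ha] using hz, h'⟩
    · obtain ⟨a, ha, -⟩ := mkP (reach_nb hS hz (M.refl z)) ((hnb S hS).1 hb z hz).insert_top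
      exact ⟨a, by simpa [ha] using hz, by rw [ha]; exact M.refl z⟩
  have good_univ : Good Set.univ := by
    obtain ⟨S, hS⟩ := M.nb_exists w
    obtain ⟨h₁, h₂⟩ := good_base S hS
    refine ⟨fun γ hγ => ?_, fun hb => ?_⟩
    · obtain ⟨a, -, ha⟩ := h₁ γ hγ
      exact ⟨a, trivial, ha⟩
    · obtain ⟨v, hv, S, hS, h⟩ := h₂ hb
      exact ⟨v, hv, S, hS, fun z hz => let ⟨a, _, ha⟩ := h z hz; ⟨a, trivial, ha⟩⟩
  have good_dia : ∀ φ, RefutesDia M b p w Γ φ → Good {a | a.1.2.2 = φ} := by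
    rintro φ ⟨h₁, h₂⟩
    refine ⟨fun γ hγ => ?_, fun hb => ?_⟩
    · obtain ⟨z, hz, h⟩ := h₂ γ hγ
      obtain ⟨a, -, ha, h', -⟩ := mkP hz h
      exact ⟨a, ha, h'⟩
    · obtain ⟨v, hv, S, hS, h⟩ := h₁ hb
      refine ⟨v, hv, S, hS, fun z hz => ?_⟩
      obtain ⟨y, hy, h⟩ := h z hz
      obtain ⟨a, ha, ha', -⟩ := mkP ⟨v, hv, S, hS, z, hz, hy⟩ h.insert_top
      exact ⟨a, ha', by rw [ha]; exact hy⟩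
  let K : Type u := {X : Set P // Good X}
  let J : K → Type u := fun X => {a : P // a ∈ X.1}
  let r : WTree.{u} := .node (RootAtom M b p w Γ) I up K ⟨_, good_univ⟩ J fun X a => pool a.1
  have le_r : ∀ {t}, WTree.model.le r t ↔ t = r ∨ ∃ i, WTree.model.le (up i) t := WTree.le_node
  have le_up : ∀ i, WTree.model.le r (up i) := fun i => le_r.2 (.inr ⟨i, WTree.model.refl _⟩)
  have nb_r : ∀ {X}, Good X → WTree.model.nb r (pool '' X) := by
    intro X hX
    refine ⟨⟨X, hX⟩, ?_⟩
    ext t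
    simp [J]
  have of_nb_r : ∀ {S}, WTree.model.nb r S → ∃ X, Good X ∧ S = pool '' X := by
    rintro S ⟨⟨X, hX⟩, rfl⟩
    refine ⟨X, hX, ?_⟩
    ext t
    simp [J]
  have not_box : ∀ φ, RefutesBox M b p w Γ φ → ¬ r.force φ.box := by
    rintro φ ⟨z, hz, h⟩ hr
    obtain ⟨a, -, -, -, ha⟩ := mkP hz h.insert_top
    exact ha (hr r (WTree.model.refl r) _ (nb_r good_univ) _ ⟨a, trivial, rfl⟩)
  have not_dia : ∀ φ, RefutesDia M b p w Γ φ → ¬ r.force φ.dia := by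
    intro φ h hr
    obtain ⟨_, ⟨a, ha, rfl⟩, h'⟩ := hr r (WTree.model.refl r) _ (nb_r (good_dia φ h))
    exact hpool₃ a (by rw [show a.1.2.2 = φ from ha]; exact h')
  have not_of_up : ∀ {v φ ψ}, M.le w v → Sat M b p v (insert φ Γ) ψ →
      ¬ r.force (.imp φ ψ) ∧ ¬ r.force ψ := by
    intro v φ ψ hv h
    obtain ⟨i, -, h₁, h₂⟩ := mkI hv h
    exact ⟨fun hr => h₂ (hr _ (le_up i) h₁), fun hr => h₂ (WTree.model.force_mono (le_up i) hr)⟩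
  have force_up : ∀ i, ∀ χ ∈ Γ, (up i).force χ := fun i χ hχ => hup₂ i χ (.inr hχ)
  have atom_r : ∀ q, r.force (.var q) ↔ RootAtom M b p w Γ q := by
    intro q
    constructor
    · exact fun h => h r (WTree.model.refl r)
    · intro hq t ht
      rcases le_r.1 ht with rfl | ⟨i, hi⟩
      · exact hq
      · rcases hq with hq | ⟨hb, hq, hw⟩
        · exact force_up i _ hq t hi
        · exact (hup₁ i hb (.var q) (by simpa [vars] using hq.symm)).2
            (M.force_mono i.2.1 hw) t hi
  have force_imp : ∀ φ ψ : Form, φ.imp ψ ∈ Γ → ¬ r.force φ → r.force (φ.imp ψ) := by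
    intro φ ψ h hφ t ht h'
    rcases le_r.1 ht with rfl | ⟨i, hi⟩
    · exact (hφ h').elim
    · exact force_up i _ h t hi h'
  refine ⟨r, fun hb χ => ?_, fun χ hχ => ?_, ?_⟩
  · have push : ∀ {χ}, p ∉ vars χ → r.force χ → ∀ v, M.le w v → v = w ∨ M.force χ v := by
      intro χ hp hr v hv
      by_cases hvw : v = w
      · exact .inl hvw
      · obtain ⟨x, hwx, hxv, h⟩ := hup hb v hv hvw
        obtain ⟨i, hi, -⟩ := mkI hwx h.insert_top
        refine .inr (M.force_mono hxv ?_)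
        rw [← hi]
        exact (hup₁ i hb χ hp).1 (WTree.model.force_mono (le_up i) hr)
    have pull : ∀ {χ}, p ∉ vars χ → M.force χ w → ∀ i, (up i).force χ := by
      intro χ hp hw i
      exact (hup₁ i hb χ hp).2 (M.force_mono i.2.1 hw)
    induction χ with
    | var q =>
      intro hp
      have hp : q ≠ p := fun h => hp (by simp [vars, h])
      rw [atom_r]
      constructor
      · rintro (h | h)
        · exact hΓ _ h hb hp
        · exact h.2.2
      · exact fun h => .inr ⟨hb, hp, h⟩
    | bot => exact fun _ => Iff.rfl
    | and φ ψ ih₁ ih₂ =>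
      intro hp
      simp only [vars, Set.mem_union, not_or] at hp
      exact and_congr (ih₁ hp.1) (ih₂ hp.2)
    | or φ ψ ih₁ ih₂ =>
      intro hp
      simp only [vars, Set.mem_union, not_or] at hp
      exact or_congr (ih₁ hp.1) (ih₂ hp.2)
    | imp φ ψ ih₁ ih₂ =>
      intro hp
      have hp' := hp
      simp only [vars, Set.mem_union, not_or] at hp'
      constructor
      · intro hr v hv h
        rcases push hp hr v hv with rfl | h'
        · exact (ih₂ hp'.2).1 (WTree.model.force_mp hr ((ih₁ hp'.1).2 h))
        · exact M.force_mp h' h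
      · intro hw t ht h
        rcases le_r.1 ht with rfl | ⟨i, hi⟩
        · exact (ih₂ hp'.2).2 (M.force_mp hw ((ih₁ hp'.1).1 h))
        · exact pull hp hw i t hi h
    | box φ ih =>
      intro hp
      constructor
      · intro hr v hv S hS z hz
        rcases push hp hr v hv with rfl | h'
        · obtain ⟨a, ha, -⟩ := mkP (reach_nb hS hz (M.refl z))
            ((hnb S hS).1 hb z hz).insert_top
          rw [← ha]
          exact (hpool₁ a hb φ hp).1
            (hr r (WTree.model.refl r) _ (nb_r good_univ) _ ⟨a, trivial, rfl⟩)
        · exact h' v (M.refl v) S hS z hz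
      · intro hw t ht S hS z hz
        rcases le_r.1 ht with rfl | ⟨i, hi⟩
        · obtain ⟨X, -, rfl⟩ := of_nb_r hS
          obtain ⟨a, -, rfl⟩ := hz
          exact (hpool₁ a hb φ hp).2 (M.force_of_reach a.2.1 hw)
        · exact pull hp hw i t hi S hS z hz
    | dia φ ih =>
      intro hp
      constructor
      · intro hr v hv S hS
        rcases push hp hr v hv with rfl | h'
        · obtain ⟨_, ⟨a, ha, rfl⟩, h⟩ :=
            hr r (WTree.model.refl r) _ (nb_r (good_base S hS))
          exact ⟨a.1.1, ha, (hpool₁ a hb φ hp).1 h⟩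
        · exact h' v (M.refl v) S hS
      · intro hw t ht S hS
        rcases le_r.1 ht with rfl | ⟨i, hi⟩
        · obtain ⟨X, hX, rfl⟩ := of_nb_r hS
          obtain ⟨v, hv, S, hS, h⟩ := hX.2 hb
          obtain ⟨z, hz, h'⟩ := hw v hv S hS
          obtain ⟨a, ha, hza⟩ := h z hz
          exact ⟨pool a, ⟨a, ha, rfl⟩, (hpool₁ a hb φ hp).2 (M.force_mono hza h')⟩
        · exact pull hp hw i t hi S hS
  · have hs := hΓ χ hχ
    match χ, hχ, hs with
    | .var q, hχ, _ => exact (atom_r q).2 (.inl hχ)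
    | .box φ, hχ, _ =>
      intro t ht S hS z hz
      rcases le_r.1 ht with rfl | ⟨i, hi⟩
      · obtain ⟨X, -, rfl⟩ := of_nb_r hS
        obtain ⟨a, -, rfl⟩ := hz
        exact hpool₂ a φ (.inr hχ)
      · exact force_up i _ hχ t hi S hS z hz
    | .dia φ, hχ, _ =>
      intro t ht S hS
      rcases le_r.1 ht with rfl | ⟨i, hi⟩
      · obtain ⟨X, hX, rfl⟩ := of_nb_r hS
        obtain ⟨a, ha, h⟩ := hX.1 φ hχ
        exact ⟨_, ⟨a, ha, rfl⟩, h⟩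
      · exact force_up i _ hχ t hi S hS
    | .imp (.var q) ψ, hχ, hs => exact force_imp _ _ hχ fun h => hs ((atom_r q).1 h)
    | .imp (.imp _ _) _, hχ, ⟨v, hv, h⟩ => exact force_imp _ _ hχ (not_of_up hv h).1
    | .imp (.box φ) _, hχ, hs => exact force_imp _ _ hχ (not_box φ hs)
    | .imp (.dia φ) _, hχ, hs => exact force_imp _ _ hχ (not_dia φ hs)
  · match δ, hδ with
    | .var q, hδ => exact fun h => hδ ((atom_r q).1 h)
    | .bot, _ => exact id
    | .and φ ψ, ⟨v, hv, h⟩ =>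
      rintro ⟨h₁, h₂⟩
      rcases h with h | h
      · exact (not_of_up hv h.insert_top).2 h₁
      · exact (not_of_up hv h.insert_top).2 h₂
    | .or φ ψ, ⟨⟨v, hv, h⟩, ⟨v', hv', h'⟩⟩ =>
      rintro (h₁ | h₁)
      · exact (not_of_up hv h.insert_top).2 h₁
      · exact (not_of_up hv' h'.insert_top).2 h₁
    | .imp φ ψ, ⟨v, hv, h⟩ => exact (not_of_up hv h).1
    | .box φ, hδ => exact not_box φ hδ
    | .dia φ, hδ => exact not_dia φ hδ

end Realisation

/-- Dyckhoff's weight of a formula. -/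
def Form.weight : Form → ℕ
  | .var _ => 1
  | .bot => 1
  | .and φ ψ => φ.weight + ψ.weight + 2
  | .or φ ψ => φ.weight + ψ.weight + 1
  | .imp φ ψ => φ.weight + ψ.weight + 1
  | .box φ => φ.weight + 1
  | .dia φ => φ.weight + 1

theorem Form.weight_pos (φ : Form) : 0 < φ.weight := by
  cases φ <;> simp [Form.weight]

def Form.cost (φ : Form) : ℕ := 4 ^ φ.weight

def cost (Γ : Multiset Form) : ℕ := (Γ.map Form.cost).sum

@[simp] theorem cost_cons (φ : Form) (Γ : Multiset Form) : cost (φ ::ₘ Γ) = φ.cost + cost Γ := by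
  simp [cost]

@[simp] theorem cost_add (Γ Δ : Multiset Form) : cost (Γ + Δ) = cost Γ + cost Δ := by
  simp [cost]

theorem Form.cost_pos (φ : Form) : 0 < φ.cost := by simp [Form.cost]

theorem Form.cost_lt {φ ψ : Form} (h : φ.weight < ψ.weight) : 4 * φ.cost ≤ ψ.cost := by
  unfold Form.cost
  calc 4 * 4 ^ φ.weight = 4 ^ (φ.weight + 1) := by ring
    _ ≤ 4 ^ ψ.weight := Nat.pow_le_pow_right (by norm_num) h

theorem cost_cons_erase {φ : Form} {Γ : Multiset Form} (h : φ ∈ Γ) :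
    φ.cost + cost (Γ.erase φ) = cost Γ := by
  rw [← cost_cons, Multiset.cons_erase h]

@[simp] theorem boxInv_cons_box (φ : Form) (Γ : Multiset Form) :
    boxInv (φ.box ::ₘ Γ) = φ ::ₘ boxInv Γ :=
  Multiset.filterMap_cons_some unboxF _ _ rfl

theorem boxInv_cons_of_unboxF_eq_none {φ : Form} (h : unboxF φ = none) (Γ : Multiset Form) :
    boxInv (φ ::ₘ Γ) = boxInv Γ :=
  Multiset.filterMap_cons_none _ _ h

theorem mem_boxInv {φ : Form} {Γ : Multiset Form} : φ ∈ boxInv Γ ↔ φ.box ∈ Γ := by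
  simp only [boxInv, Multiset.mem_filterMap]
  constructor
  · rintro ⟨χ, hχ, h⟩
    cases χ <;> simp [unboxF] at h
    exact h ▸ hχ
  · exact fun h => ⟨_, h, rfl⟩

theorem cost_boxInv_cons (φ : Form) (Γ : Multiset Form) :
    cost (boxInv (φ ::ₘ Γ)) < φ.cost + cost (boxInv Γ) := by
  cases φ with
  | box φ =>
    have := Form.cost_lt (φ := φ) (ψ := φ.box) (by simp [Form.weight])
    have := φ.cost_pos
    rw [boxInv_cons_box, cost_cons]
    omega
  | _ =>
    rw [boxInv_cons_of_unboxF_eq_none rfl]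
    exact Nat.lt_add_of_pos_left (Form.cost_pos _)

theorem cost_boxInv_le (Γ : Multiset Form) : cost (boxInv Γ) ≤ cost Γ := by
  induction Γ using Multiset.induction_on with
  | empty => simp [boxInv]
  | cons φ Γ ih =>
    have := cost_boxInv_cons φ Γ
    rw [cost_cons]
    omega

theorem cost_boxInv_lt {Γ : Multiset Form} (h : Γ ≠ 0) : cost (boxInv Γ) < cost Γ := by
  obtain ⟨φ, hφ⟩ := Multiset.exists_mem_of_ne_zero h
  obtain ⟨Γ, rfl⟩ := Multiset.exists_cons_of_mem hφ
  have := cost_boxInv_cons φ Γ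
  have := cost_boxInv_le Γ
  rw [cost_cons]
  omega

theorem cost_boxInv_of_mem {φ : Form} {Γ : Multiset Form} (h : φ ∈ Γ) (hφ : unboxF φ = none) :
    φ.cost + cost (boxInv Γ) ≤ cost Γ := by
  obtain ⟨Γ, rfl⟩ := Multiset.exists_cons_of_mem h
  have := cost_boxInv_le Γ
  rw [boxInv_cons_of_unboxF_eq_none hφ, cost_cons]
  omega

theorem cost_boxInv_of_mem_of_mem {φ ψ : Form} {Γ : Multiset Form} (h : φ ∈ Γ) (h' : ψ ∈ Γ)
    (hne : φ ≠ ψ) (hφ : unboxF φ = none) (hψ : unboxF ψ = none) :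
    φ.cost + ψ.cost + cost (boxInv Γ) ≤ cost Γ := by
  obtain ⟨Γ, rfl⟩ := Multiset.exists_cons_of_mem h
  have := cost_boxInv_of_mem ((Multiset.mem_cons.1 h').resolve_left hne.symm) hψ
  rw [boxInv_cons_of_unboxF_eq_none hφ, cost_cons]
  omega

/-- The multisets by which left decomposition replaces an antecedent formula, in the premises
that keep the succedent. -/
def expand : Form → List (Multiset Form)
  | .and φ ψ => [{φ, ψ}]
  | .or φ ψ => [{φ}, {ψ}]
  | .imp .bot _ => [0]
  | .imp (.and φ ψ) χ => [{φ.imp (ψ.imp χ)}]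
  | .imp (.or φ ψ) χ => [{φ.imp χ, ψ.imp χ}]
  | .imp (.var _) χ => [{χ}]
  | .imp (.imp _ _) χ => [{χ}]
  | .imp (.box _) χ => [{χ}]
  | .imp (.dia _) χ => [{χ}]
  | _ => []

theorem cost_expand {χ : Form} {Δ : Multiset Form} (h : Δ ∈ expand χ) : cost Δ < χ.cost := by
  have key₁ : ∀ φ : Form, φ.weight < χ.weight → Δ = {φ} → cost Δ < χ.cost := by
    rintro φ hφ rfl
    have := Form.cost_lt hφ
    have := φ.cost_pos
    simp [cost]
    omega
  have key₂ : ∀ φ ψ : Form, φ.weight < χ.weight → ψ.weight < χ.weight → Δ = {φ, ψ} →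
      cost Δ < χ.cost := by
    rintro φ ψ hφ hψ rfl
    have := Form.cost_lt hφ
    have := Form.cost_lt hψ
    have := φ.cost_pos
    simp [cost]
    omega
  unfold expand at h
  split at h <;> simp only [List.mem_cons, List.not_mem_nil, or_false] at h
  case h_1 φ ψ => exact key₂ _ _ (by simp only [Form.weight]; omega) (by simp only [Form.weight]; omega) h
  case h_2 φ ψ =>
    rcases h with h | h <;> exact key₁ _ (by simp only [Form.weight]; omega) h
  case h_3 => subst h; exact Form.cost_pos _
  case h_5 φ ψ χ =>
    have := φ.weight_pos
    have := ψ.weight_pos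
    exact key₂ _ _ (by simp only [Form.weight]; omega) (by simp only [Form.weight]; omega) h
  all_goals exact key₁ _ (by simp only [Form.weight]; omega) h

theorem cost_expand_erase {χ : Form} {Γ Δ : Multiset Form} (hχ : χ ∈ Γ) (h : Δ ∈ expand χ) :
    cost (Δ + Γ.erase χ) < cost Γ := by
  have := cost_expand h
  have := cost_cons_erase hχ
  rw [cost_add]
  omega

theorem mem_imp_cons {χ : Form} {Γ : Multiset Form} {P : Form → Prop} (hχ : P χ)
    (h : ∀ φ ∈ Γ.erase χ, P φ) : ∀ φ ∈ Γ, P φ := by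
  intro φ hφ
  by_cases hne : φ = χ
  · exact hne ▸ hχ
  · exact h φ ((Multiset.mem_erase_of_ne hne).2 hφ)

theorem WKModel.force_of_expand {W : Type u} (M : WKModel W) {w : W} {χ : Form}
    {Γ Δ : Multiset Form} (h : Δ ∈ expand χ) (hw : ∀ φ ∈ Δ + Γ.erase χ, M.force φ w) :
    ∀ φ ∈ Γ, M.force φ w := by
  refine mem_imp_cons ?_ fun φ hφ => hw φ (Multiset.mem_add.2 (.inr hφ))
  replace hw : ∀ φ ∈ Δ, M.force φ w := fun φ hφ => hw φ (Multiset.mem_add.2 (.inl hφ))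
  unfold expand at h
  split at h <;> simp only [List.mem_cons, List.not_mem_nil, or_false] at h
  case h_1 => subst h; exact ⟨hw _ (by simp), hw _ (by simp)⟩
  case h_2 =>
    rcases h with rfl | rfl
    · exact .inl (hw _ (by simp))
    · exact .inr (hw _ (by simp))
  case h_3 => exact fun _ _ h => h.elim
  case h_4 φ ψ χ =>
    subst h
    exact fun v hv h => M.force_mp (hw (φ.imp (ψ.imp χ)) (by simp) v hv h.1) h.2
  case h_5 φ ψ χ =>
    subst h
    exact fun v hv h =>
      h.elim (hw (φ.imp χ) (by simp) v hv) (hw (ψ.imp χ) (by simp) v hv)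
  all_goals
    subst h
    exact fun v hv _ => M.force_mono hv (hw _ (by simp))

theorem Sat.of_expand {W : Type u} {M : WKModel W} {b : Prop} {p : ℕ} {w : W} {χ δ : Form}
    {Γ Δ : Multiset Form} (h : Δ ∈ expand χ)
    (hs : Sat M b p w {φ | φ ∈ Δ + Γ.erase χ} δ) : Sat M b p w {φ | φ ∈ Γ} δ :=
  hs.mono fun t => WTree.model.force_of_expand h (w := t)

/-- In a succedent-refuting realisation, the premise of the rule for `(φ → ψ) → χ` realises
the conclusion. -/
theorem Sat.of_imp_imp {W : Type u} {M : WKModel W} {b : Prop} {p : ℕ} {w : W} {φ ψ χ δ : Form}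
    {Γ : Multiset Form}
    (hs : Sat M b p w {θ | θ ∈ φ ::ₘ ψ.imp χ ::ₘ Γ.erase ((φ.imp ψ).imp χ)} δ) :
    Sat M b p w (insert φ {θ | θ ∈ Γ}) δ := by
  refine hs.mono fun t ht θ hθ => ?_
  have hφ : t.force φ := ht φ (by simp)
  have hψ : t.force (ψ.imp χ) := ht _ (by simp)
  rcases hθ with rfl | hθ
  · exact hφ
  · refine mem_imp_cons (χ := (φ.imp ψ).imp χ) (P := t.force) ?_ (fun θ hθ => ht θ (by simp [hθ]))
      θ hθ
    exact fun v hv h => hψ v hv (WTree.model.force_mp h (WTree.model.force_mono hv hφ))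

theorem unboxed_mem (Γ : Multiset Form) : unboxed {φ | φ ∈ Γ} = {φ | φ ∈ boxInv Γ} := by
  ext φ
  exact mem_boxInv.symm

theorem insert_mem (φ : Form) (Γ : Multiset Form) :
    insert φ {ψ | ψ ∈ Γ} = {ψ | ψ ∈ φ ::ₘ Γ} := by
  ext ψ
  simp

namespace WKH

theorem ck {Γ : Set Form} {φ : Form} (h : CKAx φ) : WKH Γ φ := ax (.ck h)

theorem imp_self (Γ : Set Form) (φ : Form) : WKH Γ (φ.imp φ) :=
  mp (ck (.a1 φ φ)) (mp (ck (.a1 φ (φ.imp φ))) (ck (.a2 φ (φ.imp φ) φ)))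

theorem imp_intro {Γ : Set Form} {φ ψ : Form} (h : WKH (insert φ Γ) ψ) : WKH Γ (φ.imp ψ) := by
  generalize hΓ : insert φ Γ = Γ' at h
  induction h with
  | ax h => exact mp (ax h) (ck (.a1 _ _))
  | el h =>
    subst hΓ
    rcases h with rfl | h
    · exact imp_self _ _
    · exact mp (el h) (ck (.a1 _ _))
  | mp _ _ ih₁ ih₂ => exact mp (ih₁ hΓ) (mp (ih₂ hΓ) (ck (.a2 _ _ _)))
  | nec h => exact mp (nec h) (ck (.a1 _ _))

theorem cut {Γ Γ' : Set Form} {φ : Form} (h : WKH Γ φ) (hΓ : ∀ χ ∈ Γ, WKH Γ' χ) : WKH Γ' φ := by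
  induction h with
  | ax h => exact ax h
  | el h => exact hΓ _ h
  | mp _ _ ih₁ ih₂ => exact mp (ih₁ hΓ) (ih₂ hΓ)
  | nec h => exact nec h

theorem mono {Γ Γ' : Set Form} {φ : Form} (h : WKH Γ φ) (hΓ : Γ ⊆ Γ') : WKH Γ' φ :=
  h.cut fun _ hχ => el (hΓ hχ)

theorem box_unboxed {Γ : Set Form} {φ : Form} (h : WKH (unboxed Γ) φ) : WKH Γ φ.box := by
  generalize hΓ : unboxed Γ = Γ' at h
  induction h with
  | ax h => exact nec (ax h)
  | el h => subst hΓ; exact el h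
  | mp _ _ ih₁ ih₂ => exact mp (ih₁ hΓ) (mp (ih₂ hΓ) (ck (.kbox _ _)))
  | nec h => exact nec (nec h)

theorem dia_unboxed {Γ : Set Form} {γ φ : Form} (hγ : γ.dia ∈ Γ)
    (h : WKH (insert γ (unboxed Γ)) φ) : WKH Γ φ.dia :=
  mp (el hγ) (mp (box_unboxed (imp_intro h)) (ck (.kdia _ _)))

theorem bot_elim {Γ : Set Form} {φ : Form} (h : WKH Γ .bot) : WKH Γ φ := mp h (ck (.a9 _))

theorem or_elim {Γ : Set Form} {φ ψ χ : Form} (h : WKH Γ (φ.or ψ)) (h₁ : WKH (insert φ Γ) χ)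
    (h₂ : WKH (insert ψ Γ) χ) : WKH Γ χ :=
  mp h (mp (imp_intro h₂) (mp (imp_intro h₁) (ck (.a5 _ _ _))))

theorem and_intro {Γ : Set Form} {φ ψ : Form} (h₁ : WKH Γ φ) (h₂ : WKH Γ ψ) : WKH Γ (φ.and ψ) :=
  mp (imp_self Γ _ : WKH Γ (Form.top)) (mp (mp h₂ (ck (.a1 _ _)))
    (mp (mp h₁ (ck (.a1 _ _))) (ck (.a8 _ _ _))))

theorem weaken_imp {Γ : Set Form} {φ ψ : Form} (h : WKH Γ ψ) : WKH Γ (φ.imp ψ) :=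
  mp h (ck (.a1 _ _))

theorem imp_trans {Γ : Set Form} {φ ψ χ : Form} (h₁ : WKH Γ (φ.imp ψ)) (h₂ : WKH Γ (ψ.imp χ)) :
    WKH Γ (φ.imp χ) :=
  mp h₁ (mp (weaken_imp h₂) (ck (.a2 _ _ _)))

end WKH

abbrev MProv (Γ : Multiset Form) (φ : Form) : Prop := WKH {χ | χ ∈ Γ} φ

/-- If an antecedent formula is not settled, one of its decompositions preserves
underivability. -/
theorem MProv.of_expand {Γ Δ : Multiset Form} {χ δ : Form}
    (h : MProv (Δ + Γ.erase χ) δ) (hΔ : ∀ φ ∈ Δ, MProv Γ φ) : MProv Γ δ :=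
  WKH.cut h fun φ hφ => by
    rcases Multiset.mem_add.1 hφ with hφ | hφ
    · exact hΔ φ hφ
    · exact WKH.el (Multiset.mem_of_mem_erase hφ)

/-- The single-world model all of whose neighbourhoods are full. -/
def pointModel : WKModel Unit where
  le _ _ := True
  refl _ := trivial
  trans _ _ := trivial
  nb _ S := S = Set.univ
  nb_exists _ := ⟨_, rfl⟩
  val _ _ := False

theorem pointModel_reach (w z : Unit) : pointModel.Reach w z :=
  ⟨w, trivial, _, rfl, z, trivial, trivial⟩

theorem sat_of_not_prov (n : ℕ) : ∀ (Γ : Multiset Form) (δ : Form), cost Γ + δ.cost < n →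
    ¬ MProv Γ δ → Sat pointModel False 0 () {χ | χ ∈ Γ} δ := by
  induction n with
  | zero => exact fun _ _ h => absurd h (Nat.not_lt_zero _)
  | succ n ih =>
    intro Γ δ hn hΓδ
    by_cases hred : ∃ χ ∈ Γ, ∃ Δ ∈ expand χ, ¬ MProv (Δ + Γ.erase χ) δ
    · obtain ⟨χ, hχ, Δ, hΔ, h⟩ := hred
      have := cost_expand_erase hχ hΔ
      exact (ih _ _ (by omega) h).of_expand hΔ
    push Not at hred
    have hbox : ∀ φ : Form, φ.cost + cost (boxInv Γ) < n → ¬ MProv Γ φ.box →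
        RefutesBox pointModel False 0 () {χ | χ ∈ Γ} φ := by
      intro φ hc h
      refine ⟨(), pointModel_reach _ _, ?_⟩
      rw [unboxed_mem]
      refine ih _ _ (by omega) fun h' => h (WKH.box_unboxed ?_)
      rwa [unboxed_mem]
    have hdia : ∀ φ : Form, (∀ γ : Form, γ.dia ∈ Γ → γ.cost + φ.cost + cost (boxInv Γ) < n) →
        ¬ MProv Γ φ.dia → RefutesDia pointModel False 0 () {χ | χ ∈ Γ} φ := by
      intro φ hc h
      refine ⟨False.elim, fun γ hγ => ⟨(), pointModel_reach _ _, ?_⟩⟩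
      rw [unboxed_mem, insert_mem]
      have := hc γ hγ
      refine ih _ _ (by rw [cost_cons]; omega) fun h' => h (WKH.dia_unboxed hγ ?_)
      rwa [unboxed_mem, insert_mem]
    have hδpos := δ.weight_pos
    have hδcost : 4 ≤ δ.cost := by
      unfold Form.cost
      calc 4 = 4 ^ 1 := rfl
        _ ≤ _ := Nat.pow_le_pow_right (by norm_num) hδpos
    refine sat_of_settled False.elim ?_ ?_ ?_
    · rintro S rfl
      refine ⟨False.elim, fun γ hγ => ⟨(), trivial, ?_⟩⟩
      rw [unboxed_mem, insert_mem]
      have h₁ := cost_boxInv_of_mem hγ rfl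
      have h₂ := Form.cost_lt (φ := γ) (ψ := γ.dia) (by simp [Form.weight])
      have h₃ := γ.cost_pos
      have h₄ : Form.bot.cost = 4 := rfl
      refine ih _ _ (by rw [cost_cons]; omega) fun h => hΓδ (WKH.bot_elim ?_)
      refine WKH.mp (WKH.dia_unboxed (φ := .bot) hγ ?_) (WKH.ax .n)
      rwa [unboxed_mem, insert_mem]
    · intro χ hχ
      have hel : MProv Γ χ := WKH.el hχ
      have hred' := hred χ hχ
      have hcost := cost_cons_erase hχ
      match χ, hχ, hel, hred', hcost with
      | .var q, _, _, _, _ => exact False.elim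
      | .box _, _, _, _, _ => trivial
      | .dia _, _, _, _, _ => trivial
      | .bot, _, hel, _, _ => exact hΓδ hel.bot_elim
      | .and φ ψ, _, hel, h, _ =>
        refine hΓδ ((h {φ, ψ} (by simp [expand])).of_expand fun θ hθ => ?_)
        simp only [Multiset.insert_eq_cons, Multiset.mem_cons, Multiset.mem_singleton] at hθ
        rcases hθ with rfl | rfl
        · exact WKH.mp hel (WKH.ck (.a6 _ _))
        · exact WKH.mp hel (WKH.ck (.a7 _ _))
      | .or φ ψ, _, hel, h, _ =>
        refine hΓδ (WKH.or_elim hel ?_ ?_)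
        · refine (h {φ} (by simp [expand])).mono fun θ hθ => ?_
          rcases Multiset.mem_add.1 hθ with hθ | hθ
          · exact .inl (Multiset.mem_singleton.1 hθ)
          · exact .inr (Multiset.mem_of_mem_erase hθ)
        · refine (h {ψ} (by simp [expand])).mono fun θ hθ => ?_
          rcases Multiset.mem_add.1 hθ with hθ | hθ
          · exact .inl (Multiset.mem_singleton.1 hθ)
          · exact .inr (Multiset.mem_of_mem_erase hθ)
      | .imp .bot _, _, _, h, _ =>
        exact hΓδ ((h 0 (by simp [expand])).of_expand (by simp))
      | .imp (.and φ ψ) θ, _, hel, h, _ =>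
        refine hΓδ ((h {φ.imp (ψ.imp θ)} (by simp [expand])).of_expand fun _ hθ => ?_)
        rw [Multiset.mem_singleton.1 hθ]
        refine WKH.imp_intro (WKH.imp_intro (WKH.mp (WKH.and_intro (φ := φ) (ψ := ψ) ?_ ?_)
          (hel.mono fun _ h => .inr (.inr h))))
        · exact WKH.el (.inr (.inl rfl))
        · exact WKH.el (.inl rfl)
      | .imp (.or φ ψ) θ, _, hel, h, _ =>
        refine hΓδ ((h {φ.imp θ, ψ.imp θ} (by simp [expand])).of_expand fun _ hθ => ?_)
        simp only [Multiset.insert_eq_cons, Multiset.mem_cons, Multiset.mem_singleton] at hθ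
        rcases hθ with rfl | rfl
        · exact WKH.imp_trans (WKH.ck (.a3 _ _)) hel
        · exact WKH.imp_trans (WKH.ck (.a4 _ _)) hel
      | .imp (.var q) θ, _, hel, h, _ =>
        rintro (hq | hq)
        · refine hΓδ ((h {θ} (by simp [expand])).of_expand fun _ hθ => ?_)
          rw [Multiset.mem_singleton.1 hθ]
          exact WKH.mp (WKH.el hq) hel
        · exact hq.1
      | .imp (.imp φ ψ) θ, _, hel, h, hcost =>
        refine ⟨(), trivial, Sat.of_imp_imp (ψ := ψ) (χ := θ) (ih _ _ ?_ fun h' => hΓδ ?_)⟩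
        · have h₁ := Form.cost_lt (φ := φ) (ψ := (φ.imp ψ).imp θ) (by simp only [Form.weight]; omega)
          have h₂ := Form.cost_lt (φ := ψ) (ψ := (φ.imp ψ).imp θ) (by simp only [Form.weight]; omega)
          have h₃ := Form.cost_lt (φ := ψ.imp θ) (ψ := (φ.imp ψ).imp θ)
            (by have := φ.weight_pos; simp only [Form.weight]; omega)
          simp only [cost_cons]
          omega
        · refine (h {θ} (by simp [expand])).of_expand fun _ hθ => ?_
          rw [Multiset.mem_singleton.1 hθ]
          refine WKH.mp (WKH.imp_intro (h'.cut fun η hη => ?_)) hel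
          simp only [Multiset.mem_cons, Set.mem_ofPred_eq] at hη
          rcases hη with rfl | rfl | hη
          · exact WKH.el (.inl rfl)
          · exact WKH.imp_trans (WKH.ck (.a1 _ _)) (hel.mono (Set.subset_insert _ _))
          · exact WKH.el (.inr (Multiset.mem_of_mem_erase hη))
      | .imp (.box φ) θ, hχ, hel, h, _ =>
        have h₁ := cost_boxInv_of_mem hχ rfl
        have h₂ := Form.cost_lt (φ := φ) (ψ := φ.box.imp θ) (by simp only [Form.weight]; omega)
        refine hbox φ (by omega) fun h' => hΓδ ((h {θ} (by simp [expand])).of_expand fun _ hθ => ?_)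
        rw [Multiset.mem_singleton.1 hθ]
        exact WKH.mp h' hel
      | .imp (.dia φ) θ, hχ, hel, h, _ =>
        refine hdia φ (fun γ hγ => ?_)
          fun h' => hΓδ ((h {θ} (by simp [expand])).of_expand fun _ hθ => ?_)
        · have h₁ := cost_boxInv_of_mem_of_mem hγ hχ (by simp) rfl rfl
          have h₂ := Form.cost_lt (φ := φ) (ψ := φ.dia.imp θ) (by simp only [Form.weight]; omega)
          have h₃ := Form.cost_lt (φ := γ) (ψ := γ.dia) (by simp [Form.weight])
          omega
        · rw [Multiset.mem_singleton.1 hθ]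
          exact WKH.mp h' hel
    · have hbound := cost_boxInv_le Γ
      match δ, hΓδ, hn with
      | .var q, hΓδ, _ =>
        rintro (hq | hq)
        · exact hΓδ (WKH.el hq)
        · exact hq.1
      | .bot, _, _ => trivial
      | .and φ ψ, hΓδ, hn =>
        have h₁ := Form.cost_lt (φ := φ) (ψ := φ.and ψ) (by simp only [Form.weight]; omega)
        have h₂ := Form.cost_lt (φ := ψ) (ψ := φ.and ψ) (by simp only [Form.weight]; omega)
        have := φ.cost_pos
        have := ψ.cost_pos
        refine ⟨(), trivial, ?_⟩
        by_cases h : MProv Γ φ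
        · exact .inr (ih _ _ (by omega) fun h' => hΓδ (WKH.and_intro h h'))
        · exact .inl (ih _ _ (by omega) h)
      | .or φ ψ, hΓδ, hn =>
        have h₁ := Form.cost_lt (φ := φ) (ψ := φ.or ψ) (by simp only [Form.weight]; omega)
        have h₂ := Form.cost_lt (φ := ψ) (ψ := φ.or ψ) (by simp only [Form.weight]; omega)
        have := φ.cost_pos
        have := ψ.cost_pos
        exact ⟨⟨(), trivial, ih _ _ (by omega) fun h => hΓδ (WKH.mp h (WKH.ck (.a3 _ _)))⟩,
          ⟨(), trivial, ih _ _ (by omega) fun h => hΓδ (WKH.mp h (WKH.ck (.a4 _ _)))⟩⟩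
      | .imp φ ψ, hΓδ, hn =>
        have h₁ := Form.cost_lt (φ := φ) (ψ := φ.imp ψ) (by simp only [Form.weight]; omega)
        have h₂ := Form.cost_lt (φ := ψ) (ψ := φ.imp ψ) (by simp only [Form.weight]; omega)
        have := φ.cost_pos
        refine ⟨(), trivial, ?_⟩
        rw [insert_mem]
        refine ih _ _ (by rw [cost_cons]; omega) fun h => hΓδ (WKH.imp_intro ?_)
        rwa [insert_mem]
      | .box φ, hΓδ, hn =>
        have h₁ := Form.cost_lt (φ := φ) (ψ := φ.box) (by simp [Form.weight])
        have := φ.cost_pos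
        exact hbox φ (by omega) hΓδ
      | .dia φ, hΓδ, hn =>
        have h₁ := Form.cost_lt (φ := φ) (ψ := φ.dia) (by simp [Form.weight])
        have := φ.cost_pos
        refine hdia φ (fun γ hγ => ?_) hΓδ
        have h₂ := cost_boxInv_of_mem hγ rfl
        have h₃ := Form.cost_lt (φ := γ) (ψ := γ.dia) (by simp [Form.weight])
        omega

/-- Completeness of the Hilbert calculus for well-founded trees. -/
theorem complete {φ : Form} (h : ∀ t : WTree.{0}, t.force φ) : WKH ∅ φ := by
  by_contra hφ
  have hφ' : ¬ MProv 0 φ := fun h' => hφ (h'.mono fun χ hχ => absurd hχ (Multiset.notMem_zero χ))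
  obtain ⟨t, -, -, ht⟩ := sat_of_not_prov _ 0 φ (Nat.lt_succ_self _) hφ'
  exact ht (h t)

def bigAnd (l : List Form) : Form := l.foldr .and .top

def bigOr (l : List Form) : Form := l.foldr .or .bot

section BigOperators

variable {W : Type u} (M : WKModel W)

theorem WKModel.force_bigAnd {l : List Form} {w : W} :
    M.force (bigAnd l) w ↔ ∀ φ ∈ l, M.force φ w := by
  induction l with
  | nil => simpa [bigAnd] using M.force_top w
  | cons φ l ih =>
    rw [List.forall_mem_cons, ← ih]
    exact Iff.rfl

theorem WKModel.force_bigOr {l : List Form} {w : W} :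
    M.force (bigOr l) w ↔ ∃ φ ∈ l, M.force φ w := by
  induction l with
  | nil => simp [bigOr, WKModel.force]
  | cons φ l ih =>
    rw [List.exists_mem_cons_iff, ← ih]
    exact Iff.rfl

theorem vars_bigAnd_subset {l : List Form} {V : Set ℕ} (h : ∀ φ ∈ l, vars φ ⊆ V) :
    vars (bigAnd l) ⊆ V := by
  induction l with
  | nil => simp [bigAnd, Form.top, vars]
  | cons φ l ih =>
    rw [List.forall_mem_cons] at h
    exact Set.union_subset h.1 (ih h.2)

theorem vars_bigOr_subset {l : List Form} {V : Set ℕ} (h : ∀ φ ∈ l, vars φ ⊆ V) :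
    vars (bigOr l) ⊆ V := by
  induction l with
  | nil => simp [bigOr, vars]
  | cons φ l ih =>
    rw [List.forall_mem_cons] at h
    exact Set.union_subset h.1 (ih h.2)

end BigOperators

theorem MProv.force {W : Type u} {M : WKModel W} {Γ : Multiset Form} {φ : Form} (h : MProv Γ φ)
    {w : W} (hw : ∀ χ ∈ Γ, M.force χ w) : M.force φ w :=
  M.sound h w hw

theorem MProv.of_force {Γ : Multiset Form} {φ : Form}
    (h : ∀ t : WTree.{0}, (∀ χ ∈ Γ, t.force χ) → t.force φ) : MProv Γ φ := by
  by_contra hφ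
  obtain ⟨t, -, ht, hφ⟩ := sat_of_not_prov _ Γ φ (Nat.lt_succ_self _) hφ
  exact hφ (h t ht)

/-- Realisation of a sequent by a tree that is indistinguishable from `w` without `p`. -/
abbrev Realisable (p : ℕ) (w : WTree.{0}) (Γ : Multiset Form) (δ : Form) : Prop :=
  Sat WTree.model True p w {χ | χ ∈ Γ} δ

/-- `e` is a right uniform interpolant of `Γ` with respect to `p`. -/
structure IsE (p : ℕ) (Γ : Multiset Form) (e : Form) : Prop where
  vars_subset : ∀ V, (∀ χ ∈ Γ, vars χ ⊆ insert p V) → vars e ⊆ V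
  prov : MProv Γ e
  realisable : ∀ w : WTree.{0}, w.force e → Realisable p w Γ .bot

/-- `a` is a left uniform interpolant of the sequent `Γ ⇒ δ` with respect to `p`. -/
structure IsA (p : ℕ) (Γ : Multiset Form) (δ a : Form) : Prop where
  vars_subset : ∀ V, (∀ χ ∈ Γ, vars χ ⊆ insert p V) → vars δ ⊆ insert p V → vars a ⊆ V
  prov : MProv (a ::ₘ Γ) δ
  realisable : ∀ w : WTree.{0}, ¬ w.force a → ∃ v, WTree.model.le w v ∧ Realisable p v Γ δ

theorem IsA.force {p : ℕ} {Γ : Multiset Form} {δ a : Form} (h : IsA p Γ δ a) {W : Type u}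
    {M : WKModel W} {w : W} (hw : ∀ χ ∈ Γ, M.force χ w) (ha : M.force a w) : M.force δ w :=
  h.prov.force (by simpa using ⟨ha, hw⟩)

theorem IsE.notMem_vars {p : ℕ} {Γ : Multiset Form} {e : Form} (h : IsE p Γ e) : p ∉ vars e :=
  fun hp => h.vars_subset {p}ᶜ (fun _ _ q _ => by simp [em]) hp rfl

section Variables

variable {U : Set ℕ} {Γ Δ : Multiset Form} {χ : Form}

theorem vars_subset_boxInv (h : ∀ χ ∈ Γ, vars χ ⊆ U) : ∀ χ ∈ boxInv Γ, vars χ ⊆ U :=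
  fun χ hχ => h χ.box (mem_boxInv.1 hχ)

theorem vars_subset_cons (hχ : vars χ ⊆ U) (h : ∀ φ ∈ Γ, vars φ ⊆ U) :
    ∀ φ ∈ χ ::ₘ Γ, vars φ ⊆ U := by
  simpa using ⟨hχ, h⟩

theorem vars_subset_erase (h : ∀ φ ∈ Γ, vars φ ⊆ U) : ∀ φ ∈ Γ.erase χ, vars φ ⊆ U :=
  fun φ hφ => h φ (Multiset.mem_of_mem_erase hφ)

theorem vars_subset_of_mem_expand {φ : Form} (hΔ : Δ ∈ expand χ) (hφ : φ ∈ Δ) :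
    vars φ ⊆ vars χ := by
  unfold expand at hΔ
  split at hΔ <;> simp only [List.mem_cons, List.not_mem_nil, or_false] at hΔ
  case h_2 =>
    rcases hΔ with rfl | rfl <;> obtain rfl := Multiset.mem_singleton.1 hφ <;> simp [vars]
  case h_3 => simp [hΔ] at hφ
  case h_1 | h_5 =>
    subst hΔ
    simp only [Multiset.insert_eq_cons, Multiset.mem_cons, Multiset.mem_singleton] at hφ
    rcases hφ with rfl | rfl <;> intro q <;> simp only [vars, Set.mem_union] <;> tauto
  all_goals
    subst hΔ
    obtain rfl := Multiset.mem_singleton.1 hφ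
    intro q
    simp only [vars, Set.mem_union]
    tauto

theorem vars_subset_expand (hχ : χ ∈ Γ) (hΔ : Δ ∈ expand χ) (h : ∀ φ ∈ Γ, vars φ ⊆ U) :
    ∀ φ ∈ Δ + Γ.erase χ, vars φ ⊆ U := by
  intro φ hφ
  rcases Multiset.mem_add.1 hφ with hφ | hφ
  · exact (vars_subset_of_mem_expand hΔ hφ).trans (h χ hχ)
  · exact h φ (Multiset.mem_of_mem_erase hφ)

end Variables

section Guards

variable (A : Multiset Form → Form → Form) (p : ℕ) (Γ : Multiset Form)

/-- A `p`-free formula entailing the atom `q` in the presence of `Γ`. -/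
def atomGuard (q : ℕ) : Form :=
  if q = p then (if Form.var p ∈ Γ then .top else .bot) else .var q

/-- A `p`-free formula entailing `◇φ` in the presence of `Γ`. -/
noncomputable def diaGuard (φ : Form) : Form :=
  (A (boxInv Γ) φ).dia.or (bigOr (Γ.toList.map fun
    | .dia γ => (A (γ ::ₘ boxInv Γ) φ).box
    | _ => .bot))

/-- A `p`-free formula in whose presence the antecedent formula can be decomposed. -/
noncomputable def leftGuard : Form → Form
  | .var _ => .bot
  | .box _ => .bot
  | .dia _ => .bot
  | .imp (.var q) _ => atomGuard p Γ q
  | .imp (.imp φ ψ) χ => A (φ ::ₘ ψ.imp χ ::ₘ Γ.erase ((φ.imp ψ).imp χ)) ψ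
  | .imp (.box φ) _ => (A (boxInv Γ) φ).box
  | .imp (.dia φ) _ => diaGuard A Γ φ
  | _ => .top

/-- A `p`-free formula entailing the given succedent in the presence of `Γ`. -/
noncomputable def rightGuard : Form → Form
  | .var q => atomGuard p Γ q
  | .bot => .bot
  | .and φ ψ => (A Γ φ).and (A Γ ψ)
  | .or φ ψ => (A Γ φ).or (A Γ ψ)
  | .imp φ ψ => A (φ ::ₘ Γ) ψ
  | .box φ => (A (boxInv Γ) φ).box
  | .dia φ => diaGuard A Γ φ

variable {A p Γ}

theorem vars_atomGuard {V : Set ℕ} {q : ℕ} (hq : q ∈ insert p V) :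
    vars (atomGuard p Γ q) ⊆ V := by
  unfold atomGuard
  split_ifs with h h'
  · simp [Form.top, vars]
  · simp [vars]
  · simpa [vars] using hq.resolve_left h

theorem force_var_of_atomGuard {W : Type u} {M : WKModel W} {w : W} {q : ℕ}
    (hw : ∀ χ ∈ Γ, M.force χ w) (h : M.force (atomGuard p Γ q) w) : M.force (.var q) w := by
  unfold atomGuard at h
  split_ifs at h with h₁ h₂
  · exact h₁ ▸ hw _ h₂
  · exact h.elim
  · exact h

theorem not_rootAtom_of_atomGuard {w : WTree.{0}} {q : ℕ}
    (hatom : ∀ q, q ≠ p → Form.var q ∈ Γ → w.force (.var q))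
    (h : ¬ w.force (atomGuard p Γ q)) : ¬ RootAtom WTree.model True p w {χ | χ ∈ Γ} q := by
  unfold atomGuard at h
  split_ifs at h with h₁ h₂
  · exact (h (WTree.model.force_top w)).elim
  · rintro (hq | hq)
    · exact h₂ (h₁ ▸ hq)
    · exact hq.2.1 h₁
  · rintro (hq | hq)
    · exact h (hatom q h₁ hq)
    · exact h hq.2.2

theorem force_box_of_isA {φ a : Form} (ha : IsA p (boxInv Γ) φ a) {W : Type u} {M : WKModel W}
    {w : W} (hw : ∀ χ ∈ Γ, M.force χ w) (h : M.force a.box w) : M.force φ.box w :=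
  fun v hv S hS z hz => ha.force (fun _ hχ => hw _ (mem_boxInv.1 hχ) v hv S hS z hz)
    (h v hv S hS z hz)

theorem refutesBox_of_isA {φ a : Form} (ha : IsA p (boxInv Γ) φ a) {w : WTree.{0}}
    (h : ¬ w.force a.box) : RefutesBox WTree.model True p w {χ | χ ∈ Γ} φ := by
  simp only [WTree.force, WKModel.force, not_forall] at h
  obtain ⟨v, hv, S, hS, z, hz, h⟩ := h
  obtain ⟨y, hy, h⟩ := ha.realisable z h
  exact ⟨y, ⟨v, hv, S, hS, z, hz, hy⟩, by rwa [unboxed_mem]⟩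

theorem force_diaGuard {φ : Form} {W : Type u} {M : WKModel W} {w : W} :
    M.force (diaGuard A Γ φ) w ↔ M.force (A (boxInv Γ) φ).dia w ∨
      ∃ γ : Form, γ.dia ∈ Γ ∧ M.force (A (γ ::ₘ boxInv Γ) φ).box w := by
  refine or_congr Iff.rfl (M.force_bigOr.trans ?_)
  simp only [List.mem_map, Multiset.mem_toList]
  constructor
  · rintro ⟨_, ⟨χ, hχ, rfl⟩, h⟩
    split at h
    · exact ⟨_, hχ, h⟩
    · exact h.elim
  · rintro ⟨γ, hγ, h⟩
    exact ⟨_, ⟨_, hγ, rfl⟩, h⟩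

section Dia

variable {φ : Form} (h₁ : IsA p (boxInv Γ) φ (A (boxInv Γ) φ))
  (h₂ : ∀ γ : Form, γ.dia ∈ Γ → IsA p (γ ::ₘ boxInv Γ) φ (A (γ ::ₘ boxInv Γ) φ))

include h₁ h₂

theorem vars_diaGuard {V : Set ℕ} (hΓ : ∀ χ ∈ Γ, vars χ ⊆ insert p V)
    (hφ : vars φ ⊆ insert p V) : vars (diaGuard A Γ φ) ⊆ V := by
  refine Set.union_subset (h₁.vars_subset V (vars_subset_boxInv hΓ) hφ) (vars_bigOr_subset ?_)
  simp only [List.mem_map, Multiset.mem_toList]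
  rintro _ ⟨χ, hχ, rfl⟩
  split
  · next γ =>
    exact (h₂ γ hχ).vars_subset V (vars_subset_cons (hΓ γ.dia hχ) (vars_subset_boxInv hΓ)) hφ
  · simp [vars]

theorem force_dia_of_diaGuard {W : Type u} {M : WKModel W} {w : W}
    (hw : ∀ χ ∈ Γ, M.force χ w) (h : M.force (diaGuard A Γ φ) w) : M.force φ.dia w := by
  have hbox : ∀ v, M.le w v → ∀ S, M.nb v S → ∀ z ∈ S, ∀ χ ∈ boxInv Γ, M.force χ z :=
    fun v hv S hS z hz χ hχ => hw _ (mem_boxInv.1 hχ) v hv S hS z hz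
  intro v hv S hS
  rcases force_diaGuard.1 h with h | ⟨γ, hγ, h⟩
  · obtain ⟨z, hz, h⟩ := h v hv S hS
    exact ⟨z, hz, h₁.force (hbox v hv S hS z hz) h⟩
  · obtain ⟨z, hz, hγz⟩ := hw _ hγ v hv S hS
    exact ⟨z, hz, (h₂ γ hγ).force (by simpa using ⟨hγz, hbox v hv S hS z hz⟩)
      (h v hv S hS z hz)⟩

theorem refutesDia_of_diaGuard {w : WTree.{0}} (h : ¬ w.force (diaGuard A Γ φ)) :
    RefutesDia WTree.model True p w {χ | χ ∈ Γ} φ := by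
  rw [WTree.force, force_diaGuard, not_or] at h
  constructor
  · intro _
    have h := h.1
    simp only [WKModel.force, not_forall, not_exists, not_and] at h
    obtain ⟨v, hv, S, hS, h⟩ := h
    refine ⟨v, hv, S, hS, fun z hz => ?_⟩
    rw [unboxed_mem]
    exact h₁.realisable z (h z hz)
  · intro γ hγ
    have h := fun h' => h.2 ⟨γ, hγ, h'⟩
    simp only [WKModel.force, imp_false, not_forall] at h
    obtain ⟨v, hv, S, hS, z, hz, h⟩ := h
    obtain ⟨y, hy, h⟩ := (h₂ γ hγ).realisable z h
    exact ⟨y, ⟨v, hv, S, hS, z, hz, hy⟩, by rwa [unboxed_mem, insert_mem]⟩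

end Dia

section Left

variable (hA : ∀ Δ δ, cost Δ + δ.cost < cost Γ → IsA p Δ δ (A Δ δ)) {χ : Form} (hχ : χ ∈ Γ)

include hA

theorem isA_of_imp_imp_mem {φ ψ θ : Form} (h : (φ.imp ψ).imp θ ∈ Γ) :
    IsA p (φ ::ₘ ψ.imp θ ::ₘ Γ.erase ((φ.imp ψ).imp θ)) ψ
      (A (φ ::ₘ ψ.imp θ ::ₘ Γ.erase ((φ.imp ψ).imp θ)) ψ) := by
  refine hA _ _ ?_
  have := cost_cons_erase h
  have := φ.weight_pos
  have h₁ := Form.cost_lt (φ := φ) (ψ := (φ.imp ψ).imp θ) (by simp only [Form.weight]; omega)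
  have h₂ := Form.cost_lt (φ := ψ) (ψ := (φ.imp ψ).imp θ) (by simp only [Form.weight]; omega)
  have h₃ := Form.cost_lt (φ := ψ.imp θ) (ψ := (φ.imp ψ).imp θ)
    (by simp only [Form.weight]; omega)
  have := φ.cost_pos
  simp only [cost_cons]
  omega

theorem isA_of_box_imp_mem {φ θ : Form} (h : φ.box.imp θ ∈ Γ) :
    IsA p (boxInv Γ) φ (A (boxInv Γ) φ) := by
  refine hA _ _ ?_
  have := cost_boxInv_of_mem h rfl
  have := Form.cost_lt (φ := φ) (ψ := φ.box.imp θ) (by simp only [Form.weight]; omega)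
  have := φ.cost_pos
  omega

theorem isA_of_dia_imp_mem {φ θ : Form} (h : φ.dia.imp θ ∈ Γ) :
    IsA p (boxInv Γ) φ (A (boxInv Γ) φ) := by
  refine hA _ _ ?_
  have := cost_boxInv_of_mem h rfl
  have := Form.cost_lt (φ := φ) (ψ := φ.dia.imp θ) (by simp only [Form.weight]; omega)
  have := φ.cost_pos
  omega

theorem isA_of_dia_mem_of_dia_imp_mem {φ θ γ : Form} (h : φ.dia.imp θ ∈ Γ) (hγ : γ.dia ∈ Γ) :
    IsA p (γ ::ₘ boxInv Γ) φ (A (γ ::ₘ boxInv Γ) φ) := by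
  refine hA _ _ ?_
  have := cost_boxInv_of_mem_of_mem hγ h (by simp) rfl rfl
  have := Form.cost_lt (φ := φ) (ψ := φ.dia.imp θ) (by simp only [Form.weight]; omega)
  have := Form.cost_lt (φ := γ) (ψ := γ.dia) (by simp only [Form.weight]; omega)
  have := φ.cost_pos
  rw [cost_cons]
  omega

include hχ

theorem vars_leftGuard {V : Set ℕ} (hΓ : ∀ χ ∈ Γ, vars χ ⊆ insert p V) :
    vars (leftGuard A p Γ χ) ⊆ V := by
  have hV := hΓ _ hχ
  unfold leftGuard
  split
  case h_4 q θ => exact vars_atomGuard (hV (by simp [vars]))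
  case h_5 φ ψ θ =>
    simp only [vars, Set.union_subset_iff] at hV
    exact (isA_of_imp_imp_mem hA hχ).vars_subset V (vars_subset_cons hV.1.1
      (vars_subset_cons (Set.union_subset hV.1.2 hV.2) (vars_subset_erase hΓ))) hV.1.2
  case h_6 φ θ =>
    simp only [vars, Set.union_subset_iff] at hV
    exact (isA_of_box_imp_mem hA hχ).vars_subset V (vars_subset_boxInv hΓ) hV.1
  case h_7 φ θ =>
    simp only [vars, Set.union_subset_iff] at hV
    exact vars_diaGuard (isA_of_dia_imp_mem hA hχ)
      (fun γ hγ => isA_of_dia_mem_of_dia_imp_mem hA hχ hγ) hΓ hV.1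
  all_goals simp [vars, Form.top]

theorem exists_expand_of_leftGuard {W : Type u} {M : WKModel W} {w : W}
    (hw : ∀ χ ∈ Γ, M.force χ w) (h : M.force (leftGuard A p Γ χ) w) :
    ∃ Δ ∈ expand χ, ∀ φ ∈ Δ + Γ.erase χ, M.force φ w := by
  suffices ∃ Δ ∈ expand χ, ∀ φ ∈ Δ, M.force φ w by
    obtain ⟨Δ, hΔ, h⟩ := this
    refine ⟨Δ, hΔ, fun φ hφ => ?_⟩
    rcases Multiset.mem_add.1 hφ with hφ | hφ
    · exact h φ hφ
    · exact hw φ (Multiset.mem_of_mem_erase hφ)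
  have hf := hw χ hχ
  match χ, hχ, hf, h with
  | .var _, _, _, h => exact h.elim
  | .box _, _, _, h => exact h.elim
  | .dia _, _, _, h => exact h.elim
  | .bot, _, hf, _ => exact hf.elim
  | .and φ ψ, _, hf, _ => exact ⟨{φ, ψ}, by simp [expand], by simpa using ⟨hf.1, hf.2⟩⟩
  | .or φ ψ, _, hf, _ =>
    rcases hf with hf | hf
    · exact ⟨{φ}, by simp [expand], by simpa using hf⟩
    · exact ⟨{ψ}, by simp [expand], by simpa using hf⟩
  | .imp .bot θ, _, _, _ => exact ⟨0, by simp [expand], by simp⟩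
  | .imp (.and φ ψ) θ, _, hf, _ =>
    refine ⟨{φ.imp (ψ.imp θ)}, by simp [expand], ?_⟩
    simp only [Multiset.mem_singleton, forall_eq]
    exact fun v hv h₁ x hx h₂ => hf x (M.trans hv hx) ⟨M.force_mono hx h₁, h₂⟩
  | .imp (.or φ ψ) θ, _, hf, _ =>
    refine ⟨{φ.imp θ, ψ.imp θ}, by simp [expand], ?_⟩
    simp only [Multiset.insert_eq_cons, Multiset.mem_cons, Multiset.mem_singleton,
      forall_eq_or_imp, forall_eq]
    exact ⟨fun v hv h => hf v hv (.inl h), fun v hv h => hf v hv (.inr h)⟩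
  | .imp (.var q) θ, _, hf, h =>
    exact ⟨{θ}, by simp [expand],
      by simpa using M.force_mp hf (force_var_of_atomGuard hw h)⟩
  | .imp (.imp φ ψ) θ, hχ, hf, h =>
    refine ⟨{θ}, by simp [expand], ?_⟩
    simp only [Multiset.mem_singleton, forall_eq]
    refine M.force_mp hf fun v hv hφ => ?_
    refine (isA_of_imp_imp_mem hA hχ).force (M := M) (w := v) ?_ (M.force_mono hv h)
    simp only [Multiset.mem_cons, forall_eq_or_imp]
    refine ⟨hφ, fun x hx hψ => ?_, fun η hη =>
      M.force_mono hv (hw η (Multiset.mem_of_mem_erase hη))⟩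
    exact hf x (M.trans hv hx) fun y hy _ => M.force_mono hy hψ
  | .imp (.box φ) θ, hχ, hf, h =>
    exact ⟨{θ}, by simp [expand],
      by simpa using M.force_mp hf (force_box_of_isA (isA_of_box_imp_mem hA hχ) hw h)⟩
  | .imp (.dia φ) θ, hχ, hf, h =>
    exact ⟨{θ}, by simp [expand],
      by simpa using M.force_mp hf (force_dia_of_diaGuard (isA_of_dia_imp_mem hA hχ)
        (fun γ hγ => isA_of_dia_mem_of_dia_imp_mem hA hχ hγ) hw h)⟩

theorem settled_of_leftGuard {w : WTree.{0}}
    (hatom : ∀ q, q ≠ p → Form.var q ∈ Γ → w.force (.var q))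
    (h : ¬ w.force (leftGuard A p Γ χ)) : Settled WTree.model True p w {χ | χ ∈ Γ} χ := by
  have htop := WTree.model.force_top w
  match χ, hχ, h with
  | .var q, hχ, _ => exact fun _ hq => hatom q hq hχ
  | .box _, _, _ => trivial
  | .dia _, _, _ => trivial
  | .bot, _, h => exact h htop
  | .and _ _, _, h => exact h htop
  | .or _ _, _, h => exact h htop
  | .imp .bot _, _, h => exact h htop
  | .imp (.and _ _) _, _, h => exact h htop
  | .imp (.or _ _) _, _, h => exact h htop
  | .imp (.var q) θ, _, h => exact not_rootAtom_of_atomGuard hatom h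
  | .imp (.imp φ ψ) θ, hχ, h =>
    obtain ⟨v, hv, h⟩ := (isA_of_imp_imp_mem hA hχ).realisable w h
    exact ⟨v, hv, h.of_imp_imp⟩
  | .imp (.box φ) θ, hχ, h => exact refutesBox_of_isA (isA_of_box_imp_mem hA hχ) h
  | .imp (.dia φ) θ, hχ, h =>
    exact refutesDia_of_diaGuard (isA_of_dia_imp_mem hA hχ)
      (fun γ hγ => isA_of_dia_mem_of_dia_imp_mem hA hχ hγ) h

end Left

section Right

variable {δ : Form} (hA : ∀ Δ θ, cost Δ + θ.cost < cost Γ + δ.cost → IsA p Δ θ (A Δ θ))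

include hA

theorem isA_of_weight_lt {φ : Form} (h : φ.weight < δ.weight) : IsA p Γ φ (A Γ φ) := by
  refine hA _ _ ?_
  have := Form.cost_lt h
  have := φ.cost_pos
  omega

theorem isA_cons_of_weight_lt {φ ψ : Form} (hφ : φ.weight < δ.weight) (hψ : ψ.weight < δ.weight) :
    IsA p (φ ::ₘ Γ) ψ (A (φ ::ₘ Γ) ψ) := by
  refine hA _ _ ?_
  have := Form.cost_lt hφ
  have := Form.cost_lt hψ
  have := φ.cost_pos
  rw [cost_cons]
  omega

theorem isA_boxInv_of_weight_lt {φ : Form} (h : φ.weight < δ.weight) :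
    IsA p (boxInv Γ) φ (A (boxInv Γ) φ) := by
  refine hA _ _ ?_
  have := Form.cost_lt h
  have := φ.cost_pos
  have := cost_boxInv_le Γ
  omega

theorem isA_cons_boxInv_of_weight_lt {φ γ : Form} (hγ : γ.dia ∈ Γ) (h : φ.weight < δ.weight) :
    IsA p (γ ::ₘ boxInv Γ) φ (A (γ ::ₘ boxInv Γ) φ) := by
  refine hA _ _ ?_
  have := Form.cost_lt h
  have := φ.cost_pos
  have := cost_boxInv_of_mem hγ rfl
  have := Form.cost_lt (φ := γ) (ψ := γ.dia) (by simp only [Form.weight]; omega)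
  rw [cost_cons]
  omega

theorem vars_rightGuard {V : Set ℕ} (hΓ : ∀ χ ∈ Γ, vars χ ⊆ insert p V)
    (hδ : vars δ ⊆ insert p V) : vars (rightGuard A p Γ δ) ⊆ V := by
  cases δ with
  | var q => exact vars_atomGuard (hδ rfl)
  | bot => simp [rightGuard, vars]
  | and φ ψ =>
    simp only [vars, Set.union_subset_iff] at hδ
    exact Set.union_subset
      ((isA_of_weight_lt hA (by simp only [Form.weight]; omega)).vars_subset V hΓ hδ.1)
      ((isA_of_weight_lt hA (by simp only [Form.weight]; omega)).vars_subset V hΓ hδ.2)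
  | or φ ψ =>
    simp only [vars, Set.union_subset_iff] at hδ
    exact Set.union_subset
      ((isA_of_weight_lt hA (by simp only [Form.weight]; omega)).vars_subset V hΓ hδ.1)
      ((isA_of_weight_lt hA (by simp only [Form.weight]; omega)).vars_subset V hΓ hδ.2)
  | imp φ ψ =>
    simp only [vars, Set.union_subset_iff] at hδ
    exact (isA_cons_of_weight_lt hA (by simp only [Form.weight]; omega)
      (by simp only [Form.weight]; omega)).vars_subset V (vars_subset_cons hδ.1 hΓ) hδ.2
  | box φ =>
    exact (isA_boxInv_of_weight_lt hA (by simp only [Form.weight]; omega)).vars_subset V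
      (vars_subset_boxInv hΓ) hδ
  | dia φ =>
    exact vars_diaGuard (isA_boxInv_of_weight_lt hA (by simp only [Form.weight]; omega))
      (fun γ hγ => isA_cons_boxInv_of_weight_lt hA hγ (by simp only [Form.weight]; omega)) hΓ hδ

theorem force_of_rightGuard {W : Type u} {M : WKModel W} {w : W}
    (hw : ∀ χ ∈ Γ, M.force χ w) (h : M.force (rightGuard A p Γ δ) w) : M.force δ w := by
  cases δ with
  | var q => exact force_var_of_atomGuard hw h
  | bot => exact h
  | and φ ψ =>
    exact ⟨(isA_of_weight_lt hA (by simp only [Form.weight]; omega)).force hw h.1,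
      (isA_of_weight_lt hA (by simp only [Form.weight]; omega)).force hw h.2⟩
  | or φ ψ =>
    exact Or.imp ((isA_of_weight_lt hA (by simp only [Form.weight]; omega)).force hw)
      ((isA_of_weight_lt hA (by simp only [Form.weight]; omega)).force hw) h
  | imp φ ψ =>
    refine fun v hv hφ => (isA_cons_of_weight_lt hA (φ := φ) (by simp only [Form.weight]; omega)
      (by simp only [Form.weight]; omega)).force (M := M) (w := v) ?_ (M.force_mono hv h)
    simpa using ⟨hφ, fun χ hχ => M.force_mono hv (hw χ hχ)⟩
  | box φ =>
    exact force_box_of_isA (isA_boxInv_of_weight_lt hA (by simp only [Form.weight]; omega)) hw h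
  | dia φ =>
    exact force_dia_of_diaGuard (isA_boxInv_of_weight_lt hA (by simp only [Form.weight]; omega))
      (fun γ hγ => isA_cons_boxInv_of_weight_lt hA hγ (by simp only [Form.weight]; omega)) hw h

theorem refuted_of_rightGuard {w : WTree.{0}}
    (hatom : ∀ q, q ≠ p → Form.var q ∈ Γ → w.force (.var q))
    (h : ¬ w.force (rightGuard A p Γ δ)) : Refuted WTree.model True p w {χ | χ ∈ Γ} δ := by
  cases δ with
  | var q => exact not_rootAtom_of_atomGuard hatom h
  | bot => trivial
  | and φ ψ =>
    rcases not_and_or.1 h with h | h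
    · obtain ⟨v, hv, h⟩ :=
        (isA_of_weight_lt hA (φ := φ) (by simp only [Form.weight]; omega)).realisable w h
      exact ⟨v, hv, .inl h⟩
    · obtain ⟨v, hv, h⟩ :=
        (isA_of_weight_lt hA (φ := ψ) (by simp only [Form.weight]; omega)).realisable w h
      exact ⟨v, hv, .inr h⟩
  | or φ ψ =>
    obtain ⟨h₁, h₂⟩ := not_or.1 h
    exact ⟨(isA_of_weight_lt hA (by simp only [Form.weight]; omega)).realisable w h₁,
      (isA_of_weight_lt hA (by simp only [Form.weight]; omega)).realisable w h₂⟩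
  | imp φ ψ =>
    obtain ⟨v, hv, h⟩ := (isA_cons_of_weight_lt hA (φ := φ) (ψ := ψ)
      (by simp only [Form.weight]; omega) (by simp only [Form.weight]; omega)).realisable w h
    exact ⟨v, hv, by rwa [insert_mem]⟩
  | box φ =>
    exact refutesBox_of_isA (isA_boxInv_of_weight_lt hA (by simp only [Form.weight]; omega)) h
  | dia φ =>
    exact refutesDia_of_diaGuard (isA_boxInv_of_weight_lt hA (by simp only [Form.weight]; omega))
      (fun γ hγ => isA_cons_boxInv_of_weight_lt hA hγ (by simp only [Form.weight]; omega)) h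

end Right

end Guards

theorem isE_zero (p : ℕ) : IsE p 0 .top := by
  refine ⟨fun V _ => by simp [Form.top, vars], MProv.of_force fun t _ => WTree.model.force_top t,
    fun w _ => ?_⟩
  induction w with
  | node val I up K k₀ J suc ih₁ ih₂ =>
    have htop := WTree.model.force_top
    refine sat_of_settled (fun _ v hv hne => ?_) ?_ (fun χ hχ => absurd hχ (by simp)) trivial
    · rcases WTree.le_node.1 hv with rfl | ⟨i, hi⟩
      · exact (hne rfl).elim
      · exact ⟨up i, WTree.le_node.2 (.inr ⟨i, WTree.model.refl _⟩), hi, ih₁ i (htop _)⟩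
    · rintro _ ⟨k, rfl⟩
      refine ⟨?_, fun γ hγ => absurd hγ (by simp)⟩
      rintro _ z ⟨j, rfl⟩
      rw [unboxed_mem]
      exact ih₂ k j (htop _)

/-- The conjunct contributed to the right interpolant by an undecomposed atom or diamond. -/
def literalPart (E : Multiset Form → Form) (p : ℕ) (Γ : Multiset Form) : Form → Form
  | .var q => if q = p then .top else .var q
  | .dia γ => (E (γ ::ₘ boxInv Γ)).dia
  | _ => .top

section Step

variable {E : Multiset Form → Form} {A : Multiset Form → Form → Form} {p : ℕ} {Γ : Multiset Form}

theorem cost_cons_boxInv_lt {γ : Form} (hγ : γ.dia ∈ Γ) : cost (γ ::ₘ boxInv Γ) < cost Γ := by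
  have := cost_boxInv_of_mem hγ rfl
  have := Form.cost_lt (φ := γ) (ψ := γ.dia) (by simp only [Form.weight]; omega)
  have := γ.cost_pos
  rw [cost_cons]
  omega

theorem force_box_of_isE {e : Form} (he : IsE p (boxInv Γ) e) {W : Type u} {M : WKModel W}
    {w : W} (hw : ∀ χ ∈ Γ, M.force χ w) : M.force e.box w :=
  fun v hv S hS z hz => he.prov.force fun _ hχ => hw _ (mem_boxInv.1 hχ) v hv S hS z hz

theorem force_dia_of_isE {e γ : Form} (he : IsE p (γ ::ₘ boxInv Γ) e) (hγ : γ.dia ∈ Γ)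
    {W : Type u} {M : WKModel W} {w : W} (hw : ∀ χ ∈ Γ, M.force χ w) : M.force e.dia w := by
  intro v hv S hS
  obtain ⟨z, hz, h⟩ := hw _ hγ v hv S hS
  refine ⟨z, hz, he.prov.force ?_⟩
  simpa using ⟨h, fun χ hχ => hw _ (mem_boxInv.1 hχ) v hv S hS z hz⟩

theorem neighbourhoods_of_isE {w : WTree.{0}} {e : Form} (he : IsE p (boxInv Γ) e)
    (hE : ∀ γ : Form, γ.dia ∈ Γ → IsE p (γ ::ₘ boxInv Γ) (E (γ ::ₘ boxInv Γ)))
    (hbox : w.force e.box)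
    (hdia : ∀ γ : Form, γ.dia ∈ Γ → w.force (E (γ ::ₘ boxInv Γ)).dia) :
    ∀ S, WTree.model.nb w S →
      (True → ∀ z ∈ S, Sat WTree.model True p z (unboxed {χ | χ ∈ Γ}) .bot) ∧
      ∀ γ : Form, γ.dia ∈ {χ | χ ∈ Γ} →
        ∃ z ∈ S, Sat WTree.model True p z (insert γ (unboxed {χ | χ ∈ Γ})) .bot := by
  intro S hS
  rw [unboxed_mem]
  refine ⟨fun _ z hz => he.realisable z (hbox w (WTree.model.refl w) S hS z hz), fun γ hγ => ?_⟩
  obtain ⟨z, hz, h⟩ := hdia γ hγ w (WTree.model.refl w) S hS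
  rw [insert_mem]
  exact ⟨z, hz, (hE γ hγ).realisable z h⟩

theorem exists_isE (hΓ : Γ ≠ 0) (hE : ∀ Δ, cost Δ < cost Γ → IsE p Δ (E Δ))
    (hA : ∀ Δ δ, cost Δ + δ.cost < cost Γ → IsA p Δ δ (A Δ δ)) : ∃ e, IsE p Γ e := by
  have hE_box : IsE p (boxInv Γ) (E (boxInv Γ)) := hE _ (cost_boxInv_lt hΓ)
  have hE_dia : ∀ γ : Form, γ.dia ∈ Γ → IsE p (γ ::ₘ boxInv Γ) (E (γ ::ₘ boxInv Γ)) :=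
    fun γ hγ => hE _ (cost_cons_boxInv_lt hγ)
  have hE_expand : ∀ χ ∈ Γ, ∀ Δ ∈ expand χ, IsE p (Δ + Γ.erase χ) (E (Δ + Γ.erase χ)) :=
    fun χ hχ Δ hΔ => hE _ (cost_expand_erase hχ hΔ)
  refine ⟨((bigAnd (Γ.toList.map fun χ => (leftGuard A p Γ χ).imp
    (bigOr ((expand χ).map fun Δ => E (Δ + Γ.erase χ))))).and
    (bigAnd (Γ.toList.map (literalPart E p Γ)))).and (E (boxInv Γ)).box, fun V hV => ?_, ?_, ?_⟩
  · refine Set.union_subset (Set.union_subset (vars_bigAnd_subset ?_) (vars_bigAnd_subset ?_))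
      (hE_box.vars_subset V (vars_subset_boxInv hV))
    · simp only [List.mem_map, Multiset.mem_toList]
      rintro _ ⟨χ, hχ, rfl⟩
      refine Set.union_subset (vars_leftGuard hA hχ hV) (vars_bigOr_subset ?_)
      simp only [List.mem_map]
      rintro _ ⟨Δ, hΔ, rfl⟩
      exact (hE_expand χ hχ Δ hΔ).vars_subset V (vars_subset_expand hχ hΔ hV)
    · simp only [List.mem_map, Multiset.mem_toList]
      rintro _ ⟨χ, hχ, rfl⟩
      unfold literalPart
      split
      · split_ifs with hq
        · simp [vars, Form.top]
        · simpa [vars, hq] using hV _ hχ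
      · next γ =>
        exact (hE_dia γ hχ).vars_subset V
          (vars_subset_cons (hV γ.dia hχ) (vars_subset_boxInv hV))
      · simp [vars, Form.top]
  · refine MProv.of_force fun t ht => ⟨⟨WTree.model.force_bigAnd.2 ?_,
      WTree.model.force_bigAnd.2 ?_⟩, force_box_of_isE hE_box ht⟩
    · simp only [List.mem_map, Multiset.mem_toList]
      rintro _ ⟨χ, hχ, rfl⟩ v hv h
      obtain ⟨Δ, hΔ, h⟩ := exists_expand_of_leftGuard hA hχ
        (fun η hη => WTree.model.force_mono hv (ht η hη)) h
      exact WTree.model.force_bigOr.2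
        ⟨_, List.mem_map_of_mem hΔ, (hE_expand χ hχ Δ hΔ).prov.force h⟩
    · simp only [List.mem_map, Multiset.mem_toList]
      rintro _ ⟨χ, hχ, rfl⟩
      unfold literalPart
      split
      · split_ifs with hq
        · exact WTree.model.force_top t
        · exact ht _ hχ
      · exact force_dia_of_isE (hE_dia _ hχ) hχ ht
      · exact WTree.model.force_top t
  · intro w hw
    induction w with
    | node val I up K k₀ J suc ih₁ ih₂ =>
      have hup : ∀ i, WTree.model.le (.node val I up K k₀ J suc) (up i) :=
        fun i => WTree.le_node.2 (.inr ⟨i, WTree.model.refl _⟩)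
      have ih := fun i => ih₁ i (WTree.model.force_mono (hup i) hw)
      clear ih₁ ih₂
      obtain ⟨⟨hleft, hlit⟩, hbox⟩ := hw
      replace hleft := WTree.model.force_bigAnd.1 hleft
      replace hlit := WTree.model.force_bigAnd.1 hlit
      simp only [List.mem_map, Multiset.mem_toList, forall_exists_index, and_imp,
        forall_apply_eq_imp_iff₂] at hleft hlit
      have hatom : ∀ q, q ≠ p → Form.var q ∈ Γ →
          WTree.force (.var q) (.node val I up K k₀ J suc) := by
        intro q hq h
        simpa [literalPart, hq] using hlit _ h
      by_cases hred : ∃ χ ∈ Γ, ∃ Δ ∈ expand χ,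
          WTree.force (E (Δ + Γ.erase χ)) (.node val I up K k₀ J suc)
      · obtain ⟨χ, hχ, Δ, hΔ, h⟩ := hred
        exact ((hE_expand χ hχ Δ hΔ).realisable _ h).of_expand hΔ
      · refine sat_of_settled (fun _ v hv hne => ?_)
          (neighbourhoods_of_isE hE_box hE_dia hbox fun γ hγ => hlit _ hγ)
          (fun χ hχ => settled_of_leftGuard hA hχ hatom fun h => hred ?_) trivial
        · rcases WTree.le_node.1 hv with rfl | ⟨i, hi⟩
          · exact (hne rfl).elim
          · exact ⟨up i, hup i, hi, ih i⟩
        · obtain ⟨_, h', h⟩ := WTree.model.force_bigOr.1 (WTree.model.force_mp (hleft χ hχ) h)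
          obtain ⟨Δ, hΔ, rfl⟩ := List.mem_map.1 h'
          exact ⟨χ, hχ, Δ, hΔ, h⟩

theorem exists_isA {δ : Form} (hE : ∀ Δ, cost Δ < cost Γ + δ.cost → IsE p Δ (E Δ))
    (hA : ∀ Δ θ, cost Δ + θ.cost < cost Γ + δ.cost → IsA p Δ θ (A Δ θ)) : ∃ a, IsA p Γ δ a := by
  have hδ := δ.cost_pos
  have hE_self : IsE p Γ (E Γ) := hE _ (by omega)
  have hE_box : IsE p (boxInv Γ) (E (boxInv Γ)) :=
    hE _ (by have := cost_boxInv_le Γ; omega)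
  have hE_dia : ∀ γ : Form, γ.dia ∈ Γ → IsE p (γ ::ₘ boxInv Γ) (E (γ ::ₘ boxInv Γ)) :=
    fun γ hγ => hE _ (by have := cost_cons_boxInv_lt hγ; omega)
  have hA_expand : ∀ χ ∈ Γ, ∀ Δ ∈ expand χ, IsA p (Δ + Γ.erase χ) δ (A (Δ + Γ.erase χ) δ) :=
    fun χ hχ Δ hΔ => hA _ _ (by have := cost_expand_erase hχ hΔ; omega)
  have hA' : ∀ Δ θ, cost Δ + θ.cost < cost Γ → IsA p Δ θ (A Δ θ) :=
    fun Δ θ h => hA Δ θ (by omega)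
  refine ⟨(E Γ).imp ((bigOr (Γ.toList.map fun χ => (leftGuard A p Γ χ).and
    (bigAnd ((expand χ).map fun Δ => A (Δ + Γ.erase χ) δ)))).or (rightGuard A p Γ δ)),
    fun V hV hV' => ?_, ?_, ?_⟩
  · refine Set.union_subset (hE_self.vars_subset V hV)
      (Set.union_subset (vars_bigOr_subset ?_) (vars_rightGuard hA hV hV'))
    simp only [List.mem_map, Multiset.mem_toList]
    rintro _ ⟨χ, hχ, rfl⟩
    refine Set.union_subset (vars_leftGuard hA' hχ hV) (vars_bigAnd_subset ?_)
    simp only [List.mem_map]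
    rintro _ ⟨Δ, hΔ, rfl⟩
    exact (hA_expand χ hχ Δ hΔ).vars_subset V (vars_subset_expand hχ hΔ hV) hV'
  · refine MProv.of_force fun t ht => ?_
    rw [Multiset.forall_mem_cons] at ht
    obtain ⟨ha, ht⟩ := ht
    rcases WTree.model.force_mp ha (hE_self.prov.force ht) with h | h
    · obtain ⟨_, h', h⟩ := WTree.model.force_bigOr.1 h
      simp only [List.mem_map, Multiset.mem_toList] at h'
      obtain ⟨χ, hχ, rfl⟩ := h'
      obtain ⟨Δ, hΔ, hΔt⟩ := exists_expand_of_leftGuard hA' hχ ht h.1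
      exact (hA_expand χ hχ Δ hΔ).force hΔt
        (WTree.model.force_bigAnd.1 h.2 _ (List.mem_map_of_mem hΔ))
    · exact force_of_rightGuard hA ht h
  · intro w hw
    simp only [WTree.force, WKModel.force, not_forall, not_or, WKModel.force_bigOr] at hw
    obtain ⟨v, hv, he, hleft, hright⟩ := hw
    obtain ⟨t, ht, htΓ, -⟩ := hE_self.realisable v he
    have transfer : ∀ {χ}, p ∉ vars χ → t.force χ → v.force χ :=
      fun hp h => (ht trivial _ hp).1 h
    have hatom : ∀ q, q ≠ p → Form.var q ∈ Γ → v.force (.var q) :=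
      fun q hq h => transfer (by simpa [vars] using hq.symm) (htΓ _ h)
    by_cases hred : ∃ χ ∈ Γ, ∃ Δ ∈ expand χ, ¬ v.force (A (Δ + Γ.erase χ) δ)
    · obtain ⟨χ, hχ, Δ, hΔ, h⟩ := hred
      obtain ⟨x, hx, h⟩ := (hA_expand χ hχ Δ hΔ).realisable v h
      exact ⟨x, WTree.model.trans hv hx, h.of_expand hΔ⟩
    · push Not at hred
      refine ⟨v, hv, sat_of_settled (fun _ x hx _ => ⟨x, hx, WTree.model.refl x,
        hE_self.realisable x (WTree.model.force_mono hx he)⟩)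
        (neighbourhoods_of_isE hE_box hE_dia
          (transfer (χ := (E (boxInv Γ)).box) hE_box.notMem_vars (force_box_of_isE hE_box htΓ))
          fun γ hγ => transfer (χ := (E (γ ::ₘ boxInv Γ)).dia) (hE_dia γ hγ).notMem_vars
            (force_dia_of_isE (hE_dia γ hγ) hγ htΓ))
        (fun χ hχ => settled_of_leftGuard hA' hχ hatom fun h => hleft ?_)
        (refuted_of_rightGuard hA hatom hright)⟩
      refine ⟨_, List.mem_map_of_mem (Multiset.mem_toList.2 hχ), h,
        WTree.model.force_bigAnd.2 ?_⟩
      simp only [List.mem_map]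
      rintro _ ⟨Δ, hΔ, rfl⟩
      exact hred χ hχ Δ hΔ

end Step

theorem exists_interpolants (p n : ℕ) :
    (∀ Γ, cost Γ < n → ∃ e, IsE p Γ e) ∧ ∀ Γ δ, cost Γ + δ.cost < n → ∃ a, IsA p Γ δ a := by
  induction n with
  | zero =>
    exact ⟨fun _ h => absurd h (Nat.not_lt_zero _), fun _ _ h => absurd h (Nat.not_lt_zero _)⟩
  | succ n ih =>
    have hE : ∀ Γ, ∃ e, cost Γ < n → IsE p Γ e := fun Γ => by
      by_cases h : cost Γ < n
      · exact (ih.1 Γ h).imp fun _ he _ => he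
      · exact ⟨.bot, fun h' => (h h').elim⟩
    have hA : ∀ Γ δ, ∃ a, cost Γ + δ.cost < n → IsA p Γ δ a := fun Γ δ => by
      by_cases h : cost Γ + δ.cost < n
      · exact (ih.2 Γ δ h).imp fun _ ha _ => ha
      · exact ⟨.bot, fun h' => (h h').elim⟩
    choose E hE using hE
    choose A hA using hA
    refine ⟨fun Γ hΓ => ?_, fun Γ δ hΓδ => ?_⟩
    · rcases eq_or_ne Γ 0 with rfl | hne
      · exact ⟨_, isE_zero p⟩
      · exact exists_isE (E := E) (A := A) hne (fun Δ h => hE Δ (by omega))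
          fun Δ δ h => hA Δ δ (by omega)
    · exact exists_isA (E := E) (A := A) (fun Δ h => hE Δ (by omega))
        fun Δ θ h => hA Δ θ (by omega)

/-- The logic WK has the uniform interpolation property. -/
theorem WK_uniform_interpolation :
    ∀ (φ : Form) (p : ℕ),
      ∃ eφ aφ : Form,
        -- (1) p-freeness
        vars eφ ⊆ vars φ \ {p} ∧ vars aφ ⊆ vars φ \ {p} ∧
        -- (2) implication
        WKH ∅ (φ.imp eφ) ∧ WKH ∅ (aφ.imp φ) ∧
        -- (3) uniformity
        (∀ ψ : Form, p ∉ vars ψ →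
          (WKH ∅ (φ.imp ψ) → WKH ∅ (eφ.imp ψ)) ∧
          (WKH ∅ (ψ.imp φ) → WKH ∅ (ψ.imp aφ))) := by
  intro φ p
  obtain ⟨e, he⟩ := (exists_interpolants p _).1 {φ} (Nat.lt_succ_self _)
  obtain ⟨a, ha⟩ := (exists_interpolants p _).2 0 φ (Nat.lt_succ_self _)
  have hφ : vars φ ⊆ insert p (vars φ \ {p}) := by simp
  refine ⟨e, a, he.vars_subset _ (by simp), ha.vars_subset _ (by simp) hφ,
    complete fun t v _ h => he.prov.force (by simpa using h),
    complete fun t v _ h => ha.force (by simp) h,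
    fun ψ hψ => ⟨fun h => complete fun t v _ hv => ?_, fun h => complete fun t v _ hv => ?_⟩⟩
  · obtain ⟨s, hs, hsφ, -⟩ := he.realisable v hv
    exact (hs trivial ψ hψ).1
      (WTree.model.force_mp (WTree.model.sound h s (by simp)) (hsφ φ (by simp)))
  · by_contra hav
    obtain ⟨x, hx, s, hs, -, hsφ⟩ := ha.realisable v hav
    exact hsφ (WTree.model.force_mp (WTree.model.sound h s (by simp))
      ((hs trivial ψ hψ).2 (WTree.model.force_mono hx hv)))
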